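/- Let n ≥ 3, let Ω ⊂ ℝ^n be a bounded open connected set containing the origin, and set D := sup_{x ∈ Ω} |x|. Let a > 0 and set C_n(a) := (n-2)^{-2(n-1)/n} S_n if a ≥ 1/(n-2) and C_n(a) := a^{2(n-1)/n} S_n if 0 < a < 1/(n-2). Then for every u ∈ C_c^∞(Ω), ∫_Ω |∇u|² dx ≥ ((n-2)/2)² ∫_Ω u²/|x|² dx + C_n(a) · ( ∫_Ω X_1(a, |x|/D)^{2(n-1)/(n-2)} |u|^{2n/(n-2)} dx )^{(n-2)/n}. -/

import Mathlib

open MeasureTheory Real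

/-- The best Sobolev constant `S_n = π n (n-2) (Γ(n/2)/Γ(n))^(2/n)`. -/
noncomputable def sobolevConst (n : ℕ) : ℝ :=
  Real.pi * n * ((n : ℝ) - 2) * (Real.Gamma ((n : ℝ) / 2) / Real.Gamma (n : ℝ)) ^ (2 / (n : ℝ))

/-- `X_1(a,s) = (a - ln s)⁻¹`. -/
noncomputable def X1 (a s : ℝ) : ℝ := (a - Real.log s)⁻¹

theorem exists_continuous_inverse_primitive {P : Type} [TopologicalSpace P]
    {g : P → ℝ → ℝ} (hg : Continuous (Function.uncurry g))
    (hlow : ∀ p, ∃ δ > 0, ∀ y, δ ≤ g p y) (c : ℝ) :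
    ∃ S : P → ℝ → ℝ, Continuous (Function.uncurry S) ∧
      ∀ p s, ∫ y in c..S p s, g p y = s := by
  have hgp : ∀ p, Continuous (g p) := fun p => hg.comp (by fun_prop : Continuous fun y => (p, y))
  have hInt : ∀ p x y, IntervalIntegrable (g p) volume x y := fun p x y =>
    (hgp p).intervalIntegrable x y
  have hmono : ∀ p, StrictMono fun y => ∫ t in c..y, g p t := by
    intro p x y hxy
    obtain ⟨δ, hδ, hle⟩ := hlow p
    have h := intervalIntegral.intervalIntegral_pos_of_pos (hInt p x y)
      (fun t => hδ.trans_le (hle t)) hxy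
    have h2 := intervalIntegral.integral_add_adjacent_intervals (hInt p c x) (hInt p x y)
    simp only
    linarith
  have hcont : ∀ p, Continuous fun y => ∫ t in c..y, g p t := fun p =>
    intervalIntegral.continuous_primitive (hInt p) c
  have hsurj : ∀ p s, ∃ y, ∫ t in c..y, g p t = s := by
    intro p s
    obtain ⟨δ, hδ, hle⟩ := hlow p
    have key : ∀ x y, x ≤ y → δ * (y - x) ≤ ∫ t in x..y, g p t := by
      intro x y hxy
      have := intervalIntegral.integral_mono_on hxy (by simp : IntervalIntegrable (fun _ => δ) volume x y)
        (hInt p x y) (fun t _ => hle t)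
      simpa [mul_comm] using this
    have hM : 0 ≤ |s| / δ := by positivity
    have h1 := key c (c + |s| / δ) (by linarith)
    have h2 := key (c - |s| / δ) c (by linarith)
    rw [intervalIntegral.integral_symm] at h2
    have e1 : δ * (c + |s| / δ - c) = |s| := by field_simp; ring
    have e2 : δ * (c - (c - |s| / δ)) = |s| := by field_simp; ring
    rw [e1] at h1
    rw [e2] at h2
    have hs : s ∈ Set.Icc (∫ t in c..(c - |s| / δ), g p t) (∫ t in c..(c + |s| / δ), g p t) :=
      ⟨by linarith [neg_abs_le s], by linarith [le_abs_self s]⟩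
    obtain ⟨y, -, hy⟩ := intermediate_value_Icc (by linarith) (hcont p).continuousOn hs
    exact ⟨y, hy⟩
  choose S hS using hsurj
  refine ⟨S, ?_, hS⟩
  have hG : Continuous fun q : P × ℝ => ∫ t in c..q.2, g q.1 t :=
    intervalIntegral.continuous_parametric_intervalIntegral_of_continuous
      (f := fun (q : P × ℝ) t => g q.1 t) (by
        exact hg.comp (by fun_prop : Continuous fun z : (P × ℝ) × ℝ => (z.1.1, z.2))) (by fun_prop)
  rw [continuous_iff_continuousAt]
  rintro ⟨p₀, s₀⟩
  rw [ContinuousAt, Metric.tendsto_nhds]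
  intro ε hε
  simp only [Function.uncurry]
  have hlt1 : ∫ t in c..(S p₀ s₀ - ε), g p₀ t < s₀ :=
    (hmono p₀ (by linarith : S p₀ s₀ - ε < S p₀ s₀)).trans_eq (hS p₀ s₀)
  have hlt2 : s₀ < ∫ t in c..(S p₀ s₀ + ε), g p₀ t :=
    (hS p₀ s₀).symm.trans_lt (hmono p₀ (by linarith : S p₀ s₀ < S p₀ s₀ + ε))
  have c1 : Continuous fun q : P × ℝ => ∫ t in c..(S p₀ s₀ - ε), g q.1 t :=
    hG.comp (by fun_prop : Continuous fun q : P × ℝ => (q.1, S p₀ s₀ - ε))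
  have c2 : Continuous fun q : P × ℝ => ∫ t in c..(S p₀ s₀ + ε), g q.1 t :=
    hG.comp (by fun_prop : Continuous fun q : P × ℝ => (q.1, S p₀ s₀ + ε))
  filter_upwards [c1.continuousAt.eventually_lt continuous_snd.continuousAt hlt1,
    continuous_snd.continuousAt.eventually_lt c2.continuousAt hlt2] with q h1 h2
  rw [← hS q.1 q.2] at h1 h2
  have h1' := (hmono q.1).lt_iff_lt.1 h1
  have h2' := (hmono q.1).lt_iff_lt.1 h2
  rw [Real.dist_eq, abs_lt]
  constructor <;> linarith

theorem exists_monotone_transport {P : Type} [TopologicalSpace P]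
    {f g : P → ℝ → ℝ} (hf : Continuous (Function.uncurry f))
    (hg : Continuous (Function.uncurry g)) (hfpos : ∀ p x, 0 < f p x)
    (hlow : ∀ p, ∃ δ > 0, ∀ y, δ ≤ g p y) {L R : ℝ}
    (hfg : ∀ p, ∫ x in -L..L, f p x = ∫ y in -R..R, g p y) :
    ∃ T D : P → ℝ → ℝ, Continuous (Function.uncurry T) ∧ Continuous (Function.uncurry D) ∧
      (∀ p x, 0 < D p x) ∧ (∀ p x, HasDerivAt (T p) (D p x) x) ∧
      (∀ p, T p (-L) = -R) ∧ (∀ p, T p L = R) ∧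
      (∀ p x, x ∈ Set.Icc (-L) L → T p x ∈ Set.Icc (-R) R) ∧
      ∀ p x, f p x = g p (T p x) * D p x := by
  have hgp : ∀ p, Continuous (g p) := fun p => hg.comp (by fun_prop : Continuous fun y => (p, y))
  have hfp : ∀ p, Continuous (f p) := fun p => hf.comp (by fun_prop : Continuous fun y => (p, y))
  have hgpos : ∀ p y, 0 < g p y := fun p y => by
    obtain ⟨δ, hδ, h⟩ := hlow p
    exact hδ.trans_le (h y)
  obtain ⟨S, hSc, hS⟩ := exists_continuous_inverse_primitive hg hlow (-R)
  have hinj : ∀ p x y, ∫ t in -R..x, g p t = ∫ t in -R..y, g p t → x = y := by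
    intro p x y h
    have hInt := (hgp p).intervalIntegrable (μ := volume)
    have h2 := intervalIntegral.integral_add_adjacent_intervals (hInt (-R) x) (hInt x y)
    by_contra hne
    rcases lt_or_gt_of_ne hne with hlt | hlt
    · have := intervalIntegral.intervalIntegral_pos_of_pos (hInt x y) (hgpos p) hlt
      linarith
    · have := intervalIntegral.intervalIntegral_pos_of_pos (hInt y x) (hgpos p) hlt
      rw [intervalIntegral.integral_symm] at this
      linarith
  have hF : Continuous fun q : P × ℝ => ∫ t in -L..q.2, f q.1 t :=
    intervalIntegral.continuous_parametric_intervalIntegral_of_continuous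
      (f := fun (q : P × ℝ) t => f q.1 t) (by
        exact hf.comp (by fun_prop : Continuous fun z : (P × ℝ) × ℝ => (z.1.1, z.2))) (by fun_prop)
  have hT : Continuous fun q : P × ℝ => S q.1 (∫ t in -L..q.2, f q.1 t) :=
    hSc.comp (continuous_fst.prodMk hF)
  have hgT : Continuous fun q : P × ℝ => g q.1 (S q.1 (∫ t in -L..q.2, f q.1 t)) :=
    hg.comp (continuous_fst.prodMk hT)
  have hder : ∀ p x, HasDerivAt (fun x => S p (∫ t in -L..x, f p t))
      (f p x / g p (S p (∫ t in -L..x, f p t))) x := by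
    intro p x
    have h1 : HasDerivAt (S p) (g p (S p (∫ t in -L..x, f p t)))⁻¹ (∫ t in -L..x, f p t) := by
      refine HasDerivAt.of_local_left_inverse (f := fun y => ∫ t in -R..y, g p t) ?_ ?_
        (hgpos _ _).ne' (Filter.Eventually.of_forall fun s => hS p s)
      · exact (hSc.comp (by fun_prop : Continuous fun y => (p, y))).continuousAt
      · exact (hgp p).integral_hasStrictDerivAt _ _ |>.hasDerivAt
    have h2 : HasDerivAt (fun x => ∫ t in -L..x, f p t) (f p x) x :=
      ((hfp p).integral_hasStrictDerivAt _ _).hasDerivAt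
    have := h1.comp x h2
    rwa [inv_mul_eq_div] at this
  have hl : ∀ p, S p (∫ t in -L..-L, f p t) = -R := fun p => hinj p _ _ (by rw [hS]; simp)
  have hr : ∀ p, S p (∫ t in -L..L, f p t) = R := fun p => hinj p _ _ (by rw [hS]; exact hfg p)
  have hpos : ∀ p x, 0 < f p x / g p (S p (∫ t in -L..x, f p t)) :=
    fun p x => div_pos (hfpos _ _) (hgpos _ _)
  refine ⟨fun p x => S p (∫ t in -L..x, f p t),
    fun p x => f p x / g p (S p (∫ t in -L..x, f p t)), hT, ?_, hpos,
    hder, hl, hr, ?_, ?_⟩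
  · exact hf.div hgT fun q => (hgpos _ _).ne'
  · intro p x hx
    have hm : StrictMono (fun x => S p (∫ t in -L..x, f p t)) :=
      strictMono_of_hasDerivAt_pos (hder p) (hpos p)
    have h1 := hm.monotone hx.1
    have h2 := hm.monotone hx.2
    simp only [hl, hr] at h1 h2
    exact ⟨h1, h2⟩
  · intro p x
    field_simp [(hgpos p (S p (∫ t in -L..x, f p t))).ne']

/-- The cube `[-L, L]^n`. -/
abbrev cube (n : ℕ) (L : ℝ) : Set (Fin n → ℝ) := Set.Icc (fun _ => -L) (fun _ => L)

theorem setIntegral_cube_eq_prod {n : ℕ} (i : Fin (n + 1)) (L : ℝ) (F : (Fin (n + 1) → ℝ) → ℝ) :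
    ∫ x in cube (n + 1) L, F x =
      ∫ z in Set.Icc (-L) L ×ˢ cube n L, F (i.insertNth z.1 z.2) := by
  have h := (volume_preserving_piFinSuccAbove (fun _ : Fin (n + 1) => ℝ) i).symm
  rw [← h.setIntegral_preimage_emb (MeasurableEquiv.measurableEmbedding _)]
  have hset : (MeasurableEquiv.piFinSuccAbove (fun _ : Fin (n + 1) => ℝ) i).symm ⁻¹'
      cube (n + 1) L = Set.Icc (-L) L ×ˢ cube n L := by
    ext z
    simp only [Set.mem_preimage, MeasurableEquiv.piFinSuccAbove_symm_apply, Fin.insertNthEquiv,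
      Equiv.coe_fn_mk, Set.mem_prod]
    exact Fin.insertNth_mem_Icc
  rw [hset]
  rfl

theorem setIntegral_cube_insertNth {n : ℕ} (i : Fin (n + 1)) (L : ℝ)
    {F : (Fin (n + 1) → ℝ) → ℝ} (hF : Continuous F) :
    ∫ x in cube (n + 1) L, F x =
      ∫ s in Set.Icc (-L) L, ∫ x in cube n L, F (i.insertNth s x) := by
  rw [setIntegral_cube_eq_prod i]
  refine setIntegral_prod (fun z : ℝ × (Fin n → ℝ) => F (i.insertNth z.1 z.2)) ?_
  exact ((hF.comp (continuous_fst.finInsertNth i continuous_snd)).continuousOn).integrableOn_compact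
    (isCompact_Icc.prod isCompact_Icc)

theorem setIntegral_cube_insertNth' {n : ℕ} (i : Fin (n + 1)) (L : ℝ)
    {F : (Fin (n + 1) → ℝ) → ℝ} (hF : Continuous F) :
    ∫ x in cube (n + 1) L, F x =
      ∫ x in cube n L, ∫ s in Set.Icc (-L) L, F (i.insertNth s x) := by
  rw [setIntegral_cube_insertNth i L hF]
  refine integral_integral_swap ?_
  rw [Measure.prod_restrict]
  exact ((hF.comp (continuous_fst.finInsertNth i continuous_snd)).continuousOn).integrableOn_compact
    (isCompact_Icc.prod isCompact_Icc)

theorem intervalIntegral_eq_Icc {L : ℝ} (hL : 0 ≤ L) (F : ℝ → ℝ) :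
    ∫ s in Set.Icc (-L) L, F s = ∫ s in -L..L, F s := by
  rw [intervalIntegral.integral_of_le (by linarith), integral_Icc_eq_integral_Ioc]

/-- The Knothe rearrangement: a continuous triangular transport map between positive densities
on cubes, depending continuously on a parameter. -/
theorem exists_triangular_transport (n : ℕ) : ∀ {P : Type} [TopologicalSpace P]
    [FirstCountableTopology P] [LocallyCompactSpace P]
    {f g : P → (Fin n → ℝ) → ℝ} (_ : Continuous (Function.uncurry f))
    (_ : Continuous (Function.uncurry g)) (_ : ∀ p x, 0 < f p x)
    (_ : ∀ p, ∃ δ > 0, ∀ y, δ ≤ g p y) {L R : ℝ} (_ : 0 < L) (_ : 0 < R)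
    (_ : ∀ p, ∫ x in cube n L, f p x = ∫ y in cube n R, g p y),
    ∃ T D : P → (Fin n → ℝ) → (Fin n → ℝ),
      Continuous (Function.uncurry T) ∧ Continuous (Function.uncurry D) ∧
      (∀ p x i, 0 < D p x i) ∧
      (∀ p x i, HasDerivAt (fun s => T p (Function.update x i s) i) (D p x i) (x i)) ∧
      (∀ p, ∀ x ∈ cube n L, T p x ∈ cube n R) ∧
      (∀ p x, f p x = g p (T p x) * ∏ i, D p x i) ∧
      ∀ p (φ : (Fin n → ℝ) → ℝ), Continuous φ →
        ∫ x in cube n L, f p x * φ (T p x) = ∫ y in cube n R, g p y * φ y := by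
  induction n with
  | zero =>
    intro P _ _ _ f g hf hg hfpos hlow L R hL hR hfg
    have hcube : ∀ M : ℝ, cube 0 M = Set.univ := fun M => by ext; simp [cube]
    have hI : ∀ F : (Fin 0 → ℝ) → ℝ, ∫ x, F x = F default := by
      intro F
      rw [volume_pi, Measure.pi_of_empty (fun _ : Fin 0 => (volume : Measure ℝ)) default,
        integral_dirac]
    have heq : ∀ p x, f p x = g p x := by
      intro p x
      have := hfg p
      rw [hcube, hcube, setIntegral_univ, setIntegral_univ, hI, hI] at this
      rwa [Subsingleton.elim x default]
    refine ⟨fun _ x => x, fun _ x => x, continuous_snd, continuous_snd, fun _ _ i => i.elim0,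
      fun _ _ i => i.elim0, ?_, ?_, ?_⟩
    · intro p x _
      rw [hcube]; trivial
    · intro p x
      simp [heq]
    · intro p φ _
      rw [hcube, hcube]
      simp [heq]
  | succ n ih =>
    intro P _ _ _ f g hf hg hfpos hlow L R hL hR hfg
    have hfp : ∀ p, Continuous (f p) := fun p => hf.comp (by fun_prop : Continuous fun y => (p, y))
    have hgp : ∀ p, Continuous (g p) := fun p => hg.comp (by fun_prop : Continuous fun y => (p, y))
    have hcubevol : ∀ M : ℝ, 0 < M → 0 < (volume : Measure (Fin n → ℝ)).real (cube n M) := by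
      intro M hM
      rw [measureReal_def, cube, Real.volume_Icc_pi_toReal]
      · exact Finset.prod_pos fun i _ => by linarith
      · intro i; simp only; linarith
    have hcubefin : ∀ M : ℝ, (volume : Measure (Fin n → ℝ)) (cube n M) ≠ ⊤ := fun M =>
      isCompact_Icc.measure_lt_top.ne
    -- the marginals
    have hcf : Continuous fun z : (P × ℝ) × (Fin n → ℝ) => f z.1.1 (Fin.cons z.1.2 z.2) :=
      hf.comp ((continuous_fst.comp continuous_fst).prodMk
        (Continuous.finCons (continuous_snd.comp continuous_fst) continuous_snd))
    have hcg : Continuous fun z : (P × ℝ) × (Fin n → ℝ) => g z.1.1 (Fin.cons z.1.2 z.2) :=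
      hg.comp ((continuous_fst.comp continuous_fst).prodMk
        (Continuous.finCons (continuous_snd.comp continuous_fst) continuous_snd))
    have hf1 : Continuous fun q : P × ℝ => ∫ x in cube n L, f q.1 (Fin.cons q.2 x) :=
      continuous_parametric_integral_of_continuous
        (f := fun (q : P × ℝ) x => f q.1 (Fin.cons q.2 x)) hcf isCompact_Icc
    have hg1 : Continuous fun q : P × ℝ => ∫ x in cube n R, g q.1 (Fin.cons q.2 x) :=
      continuous_parametric_integral_of_continuous
        (f := fun (q : P × ℝ) x => g q.1 (Fin.cons q.2 x)) hcg isCompact_Icc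
    have hf1pos : ∀ p s, 0 < ∫ x in cube n L, f p (Fin.cons s x) := by
      intro p s
      have hc : Continuous fun x : Fin n → ℝ => f p (Fin.cons s x) :=
        hcf.comp (by fun_prop : Continuous fun x : Fin n → ℝ => ((p, s), x))
      rw [setIntegral_pos_iff_support_of_nonneg_ae]
      · have : Function.support (fun x : Fin n → ℝ => f p (Fin.cons s x)) = Set.univ := by
          ext x; simp [(hfpos p _).ne']
        rw [this, Set.univ_inter]
        exact (ENNReal.toReal_pos_iff.1 (hcubevol L hL)).1
      · exact Filter.Eventually.of_forall fun x => (hfpos p _).le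
      · exact hc.continuousOn.integrableOn_compact isCompact_Icc
    have hg1low : ∀ p, ∃ δ > 0, ∀ s, δ ≤ ∫ x in cube n R, g p (Fin.cons s x) := by
      intro p
      obtain ⟨δ, hδ, h⟩ := hlow p
      refine ⟨δ * volume.real (cube n R), mul_pos hδ (hcubevol R hR), fun s => ?_⟩
      have hc : Continuous fun x : Fin n → ℝ => g p (Fin.cons s x) :=
        hcg.comp (by fun_prop : Continuous fun x : Fin n → ℝ => ((p, s), x))
      have := setIntegral_mono (μ := volume) (s := cube n R) (f := fun _ => δ)
        (integrableOn_const (hcubefin R))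
        (hc.continuousOn.integrableOn_compact isCompact_Icc) (fun x => h (Fin.cons s x))
      simpa [mul_comm] using this
    have hmarg : ∀ p, ∫ s in -L..L, ∫ x in cube n L, f p (Fin.cons s x) =
        ∫ s in -R..R, ∫ x in cube n R, g p (Fin.cons s x) := by
      intro p
      have h := hfg p
      rw [setIntegral_cube_insertNth 0 L (hfp p), setIntegral_cube_insertNth 0 R (hgp p),
        intervalIntegral_eq_Icc hL.le, intervalIntegral_eq_Icc hR.le] at h
      simpa only [Fin.insertNth_zero'] using h
    obtain ⟨T₁, D₁, hT₁, hD₁, hD₁pos, hT₁der, hT₁l, hT₁r, hT₁mem, hT₁eq⟩ :=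
      exists_monotone_transport (f := fun p s => ∫ x in cube n L, f p (Fin.cons s x))
        (g := fun p s => ∫ x in cube n R, g p (Fin.cons s x)) hf1 hg1 hf1pos hg1low hmarg
    have hgT : Continuous fun z : (P × ℝ) × (Fin n → ℝ) =>
        g z.1.1 (Fin.cons (T₁ z.1.1 z.1.2) z.2) :=
      hcg.comp (((continuous_fst.comp continuous_fst).prodMk
        (hT₁.comp continuous_fst)).prodMk continuous_snd)
    obtain ⟨T, D, hT, hD, hDpos, hTder, hTmem, hTeq, hTpush⟩ :=
      ih (P := P × ℝ) (f := fun q x => f q.1 (Fin.cons q.2 x))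
        (g := fun q x => g q.1 (Fin.cons (T₁ q.1 q.2) x) * D₁ q.1 q.2) hcf
        (hgT.mul (hD₁.comp continuous_fst)) (fun q x => hfpos _ _)
        (by
          rintro ⟨p, s⟩
          obtain ⟨δ, hδ, h⟩ := hlow p
          exact ⟨δ * D₁ p s, mul_pos hδ (hD₁pos p s),
            fun y => mul_le_mul_of_nonneg_right (h _) (hD₁pos p s).le⟩) hL hR
        (by
          rintro ⟨p, s⟩
          simp only [integral_mul_const]
          exact hT₁eq p s)
    have htail : Continuous fun z : P × (Fin (n + 1) → ℝ) => ((z.1, z.2 0), Fin.tail z.2) := by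
      unfold Fin.tail; fun_prop
    have htail' : Continuous fun z : P × (Fin (n + 1) → ℝ) => (z.1, z.2 0) := by fun_prop
    refine ⟨fun p x => Fin.cons (T₁ p (x 0)) (T (p, x 0) (Fin.tail x)),
      fun p x => Fin.cons (D₁ p (x 0)) (D (p, x 0) (Fin.tail x)), ?_, ?_, ?_, ?_, ?_, ?_, ?_⟩
    · exact Continuous.finCons (hT₁.comp htail') (hT.comp htail)
    · exact Continuous.finCons (hD₁.comp htail') (hD.comp htail)
    · intro p x i
      refine Fin.cases ?_ (fun j => ?_) i
      · simpa using hD₁pos p _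
      · simpa using hDpos _ _ j
    · intro p x i
      refine Fin.cases ?_ (fun j => ?_) i
      · simpa using hT₁der p (x 0)
      · have := hTder (p, x 0) (Fin.tail x) j
        simpa [Fin.tail_update_succ, (Fin.succ_ne_zero _).symm] using! this
    · intro p x hx
      have h0 : x 0 ∈ Set.Icc (-L) L := ⟨hx.1 0, hx.2 0⟩
      have ht : Fin.tail x ∈ cube n L := ⟨fun i => hx.1 i.succ, fun i => hx.2 i.succ⟩
      have h1 := hT₁mem p _ h0
      have h2 := hTmem (p, x 0) _ ht
      constructor <;> intro i <;> refine Fin.cases ?_ (fun j => ?_) i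
      · simpa using h1.1
      · simpa using h2.1 j
      · simpa using h1.2
      · simpa using h2.2 j
    · intro p x
      have := hTeq (p, x 0) (Fin.tail x)
      simp only [Fin.cons_self_tail] at this
      simp only [Fin.prod_univ_succ, Fin.cons_zero, Fin.cons_succ]
      rw [this]; ring
    · intro p φ hφ
      have hFc : Continuous fun x : Fin (n + 1) → ℝ =>
          f p x * φ (Fin.cons (T₁ p (x 0)) (T (p, x 0) (Fin.tail x))) := by
        refine (hfp p).mul (hφ.comp (Continuous.finCons ?_ ?_))
        · exact hT₁.comp (htail'.comp (by fun_prop : Continuous fun x : Fin (n + 1) → ℝ => (p, x)))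
        · exact hT.comp (htail.comp (by fun_prop : Continuous fun x : Fin (n + 1) → ℝ => (p, x)))
      rw [setIntegral_cube_insertNth 0 L hFc, setIntegral_cube_insertNth 0 R (F := fun y => g p y * φ y) ((hgp p).mul hφ)]
      simp only [Fin.insertNth_zero', Fin.cons_zero, Fin.tail_cons]
      have hstep : ∀ s, ∫ x in cube n L, f p (Fin.cons s x) *
          φ (Fin.cons (T₁ p s) (T (p, s) x)) =
          ((fun t => ∫ y in cube n R, g p (Fin.cons t y) * φ (Fin.cons t y)) ∘ T₁ p) s * D₁ p s := by
        intro s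
        have := hTpush (p, s) (fun y => φ (Fin.cons (T₁ p s) y))
          (hφ.comp (Continuous.finCons continuous_const continuous_id))
        simp only at this
        rw [this]
        simp only [Function.comp]
        rw [← integral_mul_const]
        congr 1
        ext y
        ring
      simp only [hstep]
      have hcφ : Continuous fun t : ℝ =>
          ∫ y in cube n R, g p (Fin.cons t y) * φ (Fin.cons t y) := by
        refine continuous_parametric_integral_of_continuous
          (f := fun (t : ℝ) y => g p (Fin.cons t y) * φ (Fin.cons t y)) ?_ isCompact_Icc
        have hc : Continuous fun z : ℝ × (Fin n → ℝ) => (Fin.cons z.1 z.2 : Fin (n + 1) → ℝ) :=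
          Continuous.finCons continuous_fst continuous_snd
        exact ((hgp p).comp hc).mul (hφ.comp hc)
      rw [intervalIntegral_eq_Icc hL.le, intervalIntegral_eq_Icc hR.le,
        intervalIntegral.integral_comp_mul_deriv (fun x _ => hT₁der p x)
          (hD₁.comp (by fun_prop : Continuous fun x : ℝ => (p, x))).continuousOn hcφ, hT₁l, hT₁r]

theorem setIntegral_cube_mul_deriv_le {m : ℕ} (i : Fin (m + 1)) {L R b : ℝ} (hL : 0 < L)
    {W W' T D : (Fin (m + 1) → ℝ) → ℝ} (hW : Continuous W) (hW' : Continuous W')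
    (hT : Continuous T) (hD : Continuous D) (hb : 0 ≤ b)
    (hWd : ∀ x, HasDerivAt (fun s => W (Function.update x i s)) (W' x) (x i))
    (hTd : ∀ x, HasDerivAt (fun s => T (Function.update x i s)) (D x) (x i))
    (hWb : ∀ x, |x i| = L → W x = b) (hTR : ∀ x ∈ cube (m + 1) L, |T x| ≤ R) :
    ∫ x in cube (m + 1) L, W x * D x ≤
      b * (2 * R) * volume.real (cube m L) - ∫ x in cube (m + 1) L, W' x * T x := by
  have hins : ∀ x : Fin m → ℝ, Continuous fun s : ℝ => (i.insertNth s x : Fin (m + 1) → ℝ) :=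
    fun x =>
      Continuous.finInsertNth (A := fun _ => ℝ) i continuous_id continuous_const
  have hins2 : Continuous fun z : (Fin m → ℝ) × ℝ => (i.insertNth z.2 z.1 : Fin (m + 1) → ℝ) :=
    Continuous.finInsertNth (A := fun _ => ℝ) i continuous_snd continuous_fst
  have hupd : ∀ (x : Fin m → ℝ) (s t : ℝ),
      Function.update (i.insertNth s x : Fin (m + 1) → ℝ) i t = i.insertNth t x := by
    intro x s t
    simp
  rw [setIntegral_cube_insertNth' i L (F := fun x => W x * D x) (hW.mul hD),
    setIntegral_cube_insertNth' i L (F := fun x => W' x * T x) (hW'.mul hT)]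
  have hWDc : Continuous fun x => W x * D x := hW.mul hD
  have hWTc : Continuous fun x => W' x * T x := hW'.mul hT
  have hc : ∀ F : (Fin (m + 1) → ℝ) → ℝ, Continuous F → IntegrableOn
      (fun x : Fin m → ℝ => ∫ s in Set.Icc (-L) L, F (i.insertNth s x)) (cube m L) := by
    intro F hF
    refine Continuous.continuousOn ?_ |>.integrableOn_compact isCompact_Icc
    exact continuous_parametric_integral_of_continuous
        (f := fun (x : Fin m → ℝ) s => F (i.insertNth s x)) (hF.comp hins2) isCompact_Icc
  have hcV : IntegrableOn (fun _ : Fin m → ℝ => b * (2 * R)) (cube m L) :=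
    integrableOn_const isCompact_Icc.measure_lt_top.ne
  have hV : b * (2 * R) * volume.real (cube m L) = ∫ _x in cube m L, b * (2 * R) := by
    simp [mul_comm]
  rw [hV, ← integral_sub hcV (hc _ hWTc)]
  refine setIntegral_mono_on (hc _ hWDc) (hcV.sub (hc _ hWTc))
    measurableSet_Icc fun x hx => ?_
  have hmem : ∀ s ∈ Set.Icc (-L) L, (i.insertNth s x : Fin (m + 1) → ℝ) ∈ cube (m + 1) L :=
    fun s hs => Fin.insertNth_mem_Icc.2 ⟨hs, hx⟩
  have hibp := intervalIntegral.integral_mul_deriv_eq_deriv_mul (a := -L) (b := L)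
    (u := fun s => W (i.insertNth s x)) (v := fun s => T (i.insertNth s x))
    (u' := fun s => W' (i.insertNth s x)) (v' := fun s => D (i.insertNth s x))
    (fun s _ => by simpa [hupd] using hWd (i.insertNth s x))
    (fun s _ => by simpa [hupd] using hTd (i.insertNth s x))
    ((hW'.comp (hins x)).intervalIntegrable _ _) ((hD.comp (hins x)).intervalIntegrable _ _)
  rw [hWb (i.insertNth L x) (by simp [abs_of_pos hL]),
    hWb (i.insertNth (-L) x) (by simp [abs_of_pos hL])] at hibp
  rw [intervalIntegral_eq_Icc hL.le, intervalIntegral_eq_Icc hL.le]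
  rw [hibp]
  have h1 := (abs_le.1 (hTR _ (hmem L ⟨by linarith, le_rfl⟩))).2
  have h2 := (abs_le.1 (hTR _ (hmem (-L) ⟨le_rfl, by linarith⟩))).1
  have := mul_le_mul_of_nonneg_left (by linarith :
    T (i.insertNth L x) - T (i.insertNth (-L) x) ≤ 2 * R) hb
  linarith

theorem rpow_prod_le_arith_mean {n : ℕ} (hn : n ≠ 0) (D : Fin n → ℝ) (hD : ∀ i, 0 < D i) :
    (∏ i, D i) ^ (1 / (n : ℝ)) ≤ (∑ i, D i) / n := by
  have hn' : (n : ℝ) ≠ 0 := by exact_mod_cast hn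
  have := Real.geom_mean_le_arith_mean_weighted Finset.univ (fun _ : Fin n => 1 / (n : ℝ)) D
    (fun i _ => by positivity) (by simp [hn']) (fun i _ => (hD i).le)
  rw [Real.finsetProd_rpow _ _ (fun i _ => (hD i).le)] at this
  refine this.trans_eq ?_
  rw [← Finset.mul_sum]
  ring

theorem sobolev_cube_aux {n : ℕ} (hn : 3 ≤ n) {u : (Fin n → ℝ) → ℝ} (hu : ContDiff ℝ 1 u)
    {L R ε μ : ℝ} (hL : 0 < L) (hR : 0 < R) (hε : 0 < ε) (hμ : 0 < μ)
    (hsupp : ∀ x, (∃ i, |x i| = L) → u x = 0) {I K l : ℝ}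
    (hI : I = ∫ y in cube n R, ((1 + ∑ i, y i ^ 2) ^ n)⁻¹)
    (hK : K = ∫ y in cube n R, ((1 + ∑ i, y i ^ 2) ^ n)⁻¹ * ∑ i, y i ^ 2)
    (hl : 0 < l) (hmass : l * ∫ x in cube n L, (u x ^ 2 + ε ^ 2) ^ ((n : ℝ) / (n - 2)) = I) :
    n * (I + K) ≤ l ^ (1 - 1 / (n : ℝ)) *
        (n * ((ε ^ 2) ^ (((n : ℝ) - 1) / (n - 2)) * (2 * R) * volume.real (cube (n - 1) L))) +
      ((n : ℝ) - 1) / (n - 2) * l ^ (1 / 2 - 1 / (n : ℝ)) *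
        (μ * (∫ x in cube n L, ∑ i, (fderiv ℝ u x (Pi.single i 1)) ^ 2) + K / μ) := by
  have hn3 : (3 : ℝ) ≤ n := by exact_mod_cast hn
  have hn0 : (n : ℝ) ≠ 0 := by positivity
  have hn2 : (n : ℝ) - 2 ≠ 0 := by linarith
  set q : ℝ := ((n : ℝ) - 1) / (n - 2) with hq
  set p : ℝ := (n : ℝ) / (n - 2) with hp
  have hqpos : 1 < q := by rw [hq, lt_div_iff₀] <;> linarith
  have hpq : p * (1 - 1 / (n : ℝ)) = q := by rw [hp, hq]; field_simp
  have hp2 : p = 2 * q - 1 := by rw [hp, hq]; field_simp; ring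
  have hApos : ∀ x, 0 < u x ^ 2 + ε ^ 2 := fun x => by positivity
  have huc := hu.continuous
  have hAc : Continuous fun x => u x ^ 2 + ε ^ 2 := by fun_prop
  have hAr : ∀ r : ℝ, Continuous fun x => (u x ^ 2 + ε ^ 2) ^ r := fun r =>
    hAc.rpow_const fun x => Or.inl (hApos x).ne'
  have hdu : ∀ i, Continuous fun x => fderiv ℝ u x (Pi.single i 1) := fun i =>
    (hu.continuous_fderiv one_ne_zero).clm_apply continuous_const
  set clamp : (Fin n → ℝ) → Fin n → ℝ := fun y i => max (-R) (min R (y i)) with hclamp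
  have hclampc : Continuous clamp := by fun_prop
  have hclampid : ∀ y ∈ cube n R, clamp y = y := by
    intro y hy
    ext i
    have h1 := hy.1 i
    have h2 := hy.2 i
    simp only at h1 h2
    simp [hclamp, h1, h2]
  set g : (Fin n → ℝ) → ℝ := fun y => ((1 + ∑ i, clamp y i ^ 2) ^ n)⁻¹ with hg
  have hbase : ∀ y : Fin n → ℝ, 0 < 1 + ∑ i, y i ^ 2 := fun y =>
    add_pos_of_pos_of_nonneg one_pos (Finset.sum_nonneg fun i _ => sq_nonneg _)
  have hgc : Continuous g := by
    refine Continuous.inv₀ (by fun_prop) fun y => (pow_pos (hbase _) _).ne'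
  have hgcube : ∀ y ∈ cube n R, g y = ((1 + ∑ i, y i ^ 2) ^ n)⁻¹ := fun y hy => by
    simp only [hg, hclampid y hy]
  have hglow : ∀ y, ((1 + n * R ^ 2) ^ n)⁻¹ ≤ g y := by
    intro y
    refine inv_anti₀ (pow_pos (hbase _) _) (pow_le_pow_left₀ (hbase _).le ?_ _)
    have : ∑ i, clamp y i ^ 2 ≤ ∑ _i : Fin n, R ^ 2 := by
      refine Finset.sum_le_sum fun i _ => ?_
      refine sq_le_sq' (le_max_left _ _) (max_le (by linarith) (min_le_left _ _))
    simpa using this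
  obtain ⟨T, D, hT, hD, hDpos, hTder, hTmem, hTeq, hTpush⟩ :=
    exists_triangular_transport n (P := Unit)
      (f := fun _ x => l * (u x ^ 2 + ε ^ 2) ^ p) (g := fun _ => g)
      (by exact (continuous_const.mul (hAr p)).comp continuous_snd)
      (by exact hgc.comp continuous_snd) (fun _ x => by have := hApos x; positivity)
      (fun _ => ⟨_, by positivity, hglow⟩) hL hR
      (fun _ => by
        rw [integral_const_mul, hmass, hI]
        exact setIntegral_congr_fun measurableSet_Icc fun y hy => (hgcube y hy).symm)
  replace hT : Continuous (T ()) := hT.comp (by fun_prop : Continuous fun x => ((), x))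
  replace hD : Continuous (D ()) := hD.comp (by fun_prop : Continuous fun x => ((), x))
  replace hDpos := hDpos ()
  replace hTder := hTder ()
  replace hTmem := hTmem ()
  replace hTeq := hTeq ()
  replace hTpush := hTpush ()
  generalize T () = T at *
  generalize D () = D at *
  have hTc : ∀ i, Continuous fun x => T x i := fun i => (continuous_apply i).comp hT
  have hDc : ∀ i, Continuous fun x => D x i := fun i => (continuous_apply i).comp hD
  have hInt : ∀ F : (Fin n → ℝ) → ℝ, Continuous F → IntegrableOn F (cube n L) := fun F hF =>
    hF.continuousOn.integrableOn_compact isCompact_Icc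
  have hIntR : ∀ F : (Fin n → ℝ) → ℝ, Continuous F → IntegrableOn F (cube n R) := fun F hF =>
    hF.continuousOn.integrableOn_compact isCompact_Icc
  have hpow : Continuous fun y : Fin n → ℝ => ((1 + ∑ i, y i ^ 2) ^ n)⁻¹ :=
    Continuous.inv₀ (by fun_prop) fun y => (pow_pos (hbase _) _).ne'
  have hKT : ∫ x in cube n L, l * (u x ^ 2 + ε ^ 2) ^ p * ∑ i, T x i ^ 2 = K := by
    rw [hTpush (fun y => ∑ i, y i ^ 2) (by fun_prop), hK]
    exact setIntegral_congr_fun measurableSet_Icc fun y hy => by simp only [hgcube y hy]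
  have hIKT : ∫ x in cube n L, l * (u x ^ 2 + ε ^ 2) ^ p * (1 + ∑ i, T x i ^ 2) = I + K := by
    rw [hTpush (fun y => 1 + ∑ i, y i ^ 2) (by fun_prop), hK, hI, ← integral_add]
    · exact setIntegral_congr_fun measurableSet_Icc fun y hy => by simp only [hgcube y hy]; ring
    · exact hIntR _ hpow
    · exact hIntR _ (hpow.mul (by fun_prop))
  -- arithmetic-geometric mean inequality
  have hamgm : ∀ x ∈ cube n L, l * (u x ^ 2 + ε ^ 2) ^ p * (1 + ∑ i, T x i ^ 2) ≤
      l ^ (1 - 1 / (n : ℝ)) * (u x ^ 2 + ε ^ 2) ^ q * ((∑ i, D x i) / n) := by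
    intro x hx
    have hfpos : 0 < l * (u x ^ 2 + ε ^ 2) ^ p := by have := hApos x; positivity
    have e1 : (l * (u x ^ 2 + ε ^ 2) ^ p) ^ (1 - 1 / (n : ℝ)) =
        l ^ (1 - 1 / (n : ℝ)) * (u x ^ 2 + ε ^ 2) ^ q := by
      rw [Real.mul_rpow hl.le (Real.rpow_nonneg (hApos x).le _), ← Real.rpow_mul (hApos x).le, hpq]
    have e2 : (l * (u x ^ 2 + ε ^ 2) ^ p) ^ (1 / (n : ℝ)) * (1 + ∑ i, T x i ^ 2) =
        (∏ i, D x i) ^ (1 / (n : ℝ)) := by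
      rw [hTeq x, hgcube _ (hTmem x hx), Real.mul_rpow (inv_nonneg.2 (pow_pos (hbase _) _).le)
        (Finset.prod_nonneg fun i _ => (hDpos x i).le), Real.inv_rpow (pow_pos (hbase _) _).le,
        one_div, Real.pow_rpow_inv_natCast (hbase _).le (by omega)]
      have := (hbase (T x)).ne'
      field_simp
    have e3 : l * (u x ^ 2 + ε ^ 2) ^ p = (l * (u x ^ 2 + ε ^ 2) ^ p) ^ (1 - 1 / (n : ℝ)) *
        (l * (u x ^ 2 + ε ^ 2) ^ p) ^ (1 / (n : ℝ)) := by
      rw [← Real.rpow_add hfpos]; simp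
    rw [← e1]
    calc l * (u x ^ 2 + ε ^ 2) ^ p * (1 + ∑ i, T x i ^ 2)
        = (l * (u x ^ 2 + ε ^ 2) ^ p) ^ (1 - 1 / (n : ℝ)) *
          ((l * (u x ^ 2 + ε ^ 2) ^ p) ^ (1 / (n : ℝ)) * (1 + ∑ i, T x i ^ 2)) := by
            rw [← mul_assoc, ← e3]
      _ ≤ _ := by
            rw [e2]
            exact mul_le_mul_of_nonneg_left
              (rpow_prod_le_arith_mean (by omega) (D x) (hDpos x))
              (Real.rpow_nonneg hfpos.le _)
  have hW : Continuous fun x => (u x ^ 2 + ε ^ 2) ^ q := hAr q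
  set W' : Fin n → (Fin n → ℝ) → ℝ := fun i x =>
    2 * u x * fderiv ℝ u x (Pi.single i 1) * q * (u x ^ 2 + ε ^ 2) ^ (q - 1) with hW'
  have hW'c : ∀ i, Continuous (W' i) := fun i =>
    (((continuous_const.mul huc).mul (hdu i)).mul continuous_const).mul (hAr _)
  have hWd : ∀ i x, HasDerivAt (fun s => (u (Function.update x i s) ^ 2 + ε ^ 2) ^ q)
      (W' i x) (x i) := by
    intro i x
    have h1 : HasDerivAt (fun s => u (Function.update x i s)) (fderiv ℝ u x (Pi.single i 1))
        (x i) := by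
      have h2 : HasFDerivAt u (fderiv ℝ u x) (Function.update x i (x i)) := by
        rw [Function.update_eq_self]
        exact (hu.differentiable one_ne_zero x).hasFDerivAt
      exact h2.comp_hasDerivAt (x i) (hasDerivAt_update x i (x i))
    have h3 := ((h1.pow 2).add_const (ε ^ 2)).rpow_const (p := q)
      (Or.inl (by simpa using (hApos x).ne'))
    simpa [hW', mul_assoc] using h3
  have hparts : ∀ i, ∫ x in cube n L, (u x ^ 2 + ε ^ 2) ^ q * D x i ≤
      (ε ^ 2) ^ q * (2 * R) * volume.real (cube (n - 1) L) -
        ∫ x in cube n L, W' i x * T x i := by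
    obtain ⟨m, rfl⟩ : ∃ m, n = m + 1 := ⟨n - 1, by omega⟩
    intro i
    refine setIntegral_cube_mul_deriv_le i hL hW (hW'c i) (hTc i) (hDc i) (by positivity)
      (hWd i) (fun x => hTder x i) (fun x hx => ?_) fun x hx => ?_
    · simp [hsupp x ⟨i, hx⟩]
    · exact abs_le.2 ⟨(hTmem x hx).1 i, (hTmem x hx).2 i⟩
  have hyoung : ∀ i x, -(l ^ (1 - 1 / (n : ℝ)) * (W' i x * T x i)) ≤
      q * l ^ (1 / 2 - 1 / (n : ℝ)) * (μ * (fderiv ℝ u x (Pi.single i 1)) ^ 2 +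
        l * (u x ^ 2 + ε ^ 2) ^ p * T x i ^ 2 / μ) := by
    intro i x
    have e1 : l ^ (1 - 1 / (n : ℝ)) = l ^ (1 / 2 - 1 / (n : ℝ)) * √l := by
      rw [Real.sqrt_eq_rpow, ← Real.rpow_add hl]; ring_nf
    have e2 : u x ^ 2 * ((u x ^ 2 + ε ^ 2) ^ (q - 1)) ^ 2 ≤ (u x ^ 2 + ε ^ 2) ^ p := by
      have : (u x ^ 2 + ε ^ 2) ^ p =
          (u x ^ 2 + ε ^ 2) * ((u x ^ 2 + ε ^ 2) ^ (q - 1)) ^ 2 := by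
        rw [← Real.rpow_natCast (_ ^ (q - 1)), ← Real.rpow_mul (hApos x).le,
          ← Real.rpow_one_add' (hApos x).le (by push_cast; linarith), hp2]
        congr 1; push_cast; ring
      rw [this]
      exact mul_le_mul_of_nonneg_right (by nlinarith [sq_nonneg ε]) (sq_nonneg _)
    set d := fderiv ℝ u x (Pi.single i 1)
    set B := (u x ^ 2 + ε ^ 2) ^ (q - 1)
    have e3 : -(2 * (√l * u x * B * T x i) * d) ≤ μ * d ^ 2 + (√l * u x * B * T x i) ^ 2 / μ := by
      have : 0 ≤ (μ * d + √l * u x * B * T x i) ^ 2 / μ := by positivity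
      have e : (μ * d + √l * u x * B * T x i) ^ 2 / μ = μ * d ^ 2 +
        2 * (√l * u x * B * T x i) * d + (√l * u x * B * T x i) ^ 2 / μ := by
          field_simp; ring
      linarith
    have e4 : (√l * u x * B * T x i) ^ 2 ≤ l * (u x ^ 2 + ε ^ 2) ^ p * T x i ^ 2 := by
      have : (√l * u x * B * T x i) ^ 2 = l * (u x ^ 2 * B ^ 2) * T x i ^ 2 := by
        rw [mul_pow, mul_pow, mul_pow, Real.sq_sqrt hl.le]; ring
      rw [this]
      exact mul_le_mul_of_nonneg_right (mul_le_mul_of_nonneg_left e2 hl.le) (sq_nonneg _)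
    have e5 := div_le_div_of_nonneg_right e4 hμ.le
    calc -(l ^ (1 - 1 / (n : ℝ)) * (W' i x * T x i))
        = q * l ^ (1 / 2 - 1 / (n : ℝ)) * -(2 * (√l * u x * B * T x i) * d) := by
          rw [e1]; simp only [hW']; ring
      _ ≤ _ := mul_le_mul_of_nonneg_left (e3.trans (by linarith))
          (mul_nonneg (by linarith) (Real.rpow_nonneg hl.le _))
  set c := l ^ (1 - 1 / (n : ℝ)) with hc
  have hcpos : 0 < c := Real.rpow_pos_of_pos hl _
  set V := (ε ^ 2) ^ q * (2 * R) * volume.real (cube (n - 1) L) with hV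
  have step1 : n * (I + K) ≤ c * ∑ i, ∫ x in cube n L, (u x ^ 2 + ε ^ 2) ^ q * D x i := by
    rw [← hIKT]
    have h := setIntegral_mono_on
      (hInt (fun x => l * (u x ^ 2 + ε ^ 2) ^ p * (1 + ∑ i, T x i ^ 2))
        ((continuous_const.mul (hAr p)).mul (by fun_prop)))
      (hInt (fun x => c * (u x ^ 2 + ε ^ 2) ^ q * ((∑ i, D x i) / n)) ((continuous_const.mul (hAr q)).mul (by fun_prop))) measurableSet_Icc hamgm
    have e : ∫ x in cube n L, c * (u x ^ 2 + ε ^ 2) ^ q * ((∑ i, D x i) / n) =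
        c * (∑ i, ∫ x in cube n L, (u x ^ 2 + ε ^ 2) ^ q * D x i) / n := by
      rw [← integral_finsetSum _ (fun i _ => hInt (fun x => (u x ^ 2 + ε ^ 2) ^ q * D x i) (hW.mul (hDc i))), ← integral_const_mul,
        ← integral_div]
      congr 1
      ext x
      rw [← Finset.mul_sum]; ring
    rw [e, le_div_iff₀ (by positivity)] at h
    linarith
  have step2 : c * ∑ i, ∫ x in cube n L, (u x ^ 2 + ε ^ 2) ^ q * D x i ≤
      c * (n * V) + ∑ i, ∫ x in cube n L, -(c * (W' i x * T x i)) := by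
    have : ∑ i, ∫ x in cube n L, (u x ^ 2 + ε ^ 2) ^ q * D x i ≤
        ∑ i, (V - ∫ x in cube n L, W' i x * T x i) := Finset.sum_le_sum fun i _ => hparts i
    refine (mul_le_mul_of_nonneg_left this hcpos.le).trans_eq ?_
    simp only [integral_neg, integral_const_mul, Finset.sum_sub_distrib, Finset.sum_const,
      Finset.card_univ, Fintype.card_fin, nsmul_eq_mul, mul_sub, Finset.mul_sum,
      Finset.sum_neg_distrib]
    ring
  have step3 : ∑ i, ∫ x in cube n L, -(c * (W' i x * T x i)) ≤
      q * l ^ (1 / 2 - 1 / (n : ℝ)) *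
        (μ * (∫ x in cube n L, ∑ i, (fderiv ℝ u x (Pi.single i 1)) ^ 2) + K / μ) := by
    rw [← hKT]
    have hi1 : ∀ i, IntegrableOn (fun x => (fderiv ℝ u x (Pi.single i 1)) ^ 2) (cube n L) :=
      fun i => hInt _ ((hdu i).pow 2)
    have hi2 : ∀ i, IntegrableOn (fun x => l * (u x ^ 2 + ε ^ 2) ^ p * T x i ^ 2) (cube n L) :=
      fun i => hInt _ ((continuous_const.mul (hAr p)).mul ((hTc i).pow 2))
    have hsum : ∀ x, l * (u x ^ 2 + ε ^ 2) ^ p * ∑ i, T x i ^ 2 =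
        ∑ i, l * (u x ^ 2 + ε ^ 2) ^ p * T x i ^ 2 := fun x => Finset.mul_sum _ _ _
    simp only [hsum]
    rw [integral_finsetSum _ fun i _ => hi1 i, integral_finsetSum _ fun i _ => hi2 i,
      Finset.mul_sum, Finset.sum_div, ← Finset.sum_add_distrib, Finset.mul_sum]
    refine Finset.sum_le_sum fun i _ => ?_
    rw [← integral_const_mul, ← integral_div, ← integral_add ((hi1 i).const_mul _)
      ((hi2 i).div_const _), ← integral_const_mul]
    exact setIntegral_mono (hInt _ (continuous_const.mul ((hW'c i).mul (hTc i))).neg)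
      (((hi1 i).const_mul _).add ((hi2 i).div_const _) |>.const_mul _) (hyoung i)
  linarith

theorem integral_rpow_one_add_norm_sq {n : ℕ} {s : ℝ} (hs0 : 0 < s) (hs : (n : ℝ) / 2 < s) :
    Integrable (fun x : EuclideanSpace ℝ (Fin n) => (1 + ‖x‖ ^ 2) ^ (-s)) ∧
    ∫ x : EuclideanSpace ℝ (Fin n), (1 + ‖x‖ ^ 2) ^ (-s) =
      π ^ ((n : ℝ) / 2) * Gamma (s - n / 2) / Gamma s := by
  have hb : ∀ x : EuclideanSpace ℝ (Fin n), 0 < 1 + ‖x‖ ^ 2 := fun x => by positivity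
  have hG : 0 < Gamma s := Gamma_pos_of_pos hs0
  have hInt : Integrable (fun x : EuclideanSpace ℝ (Fin n) => (1 + ‖x‖ ^ 2) ^ (-s)) := by
    have := integrable_rpow_neg_one_add_norm_sq (E := EuclideanSpace ℝ (Fin n))
      (μ := volume) (r := 2 * s) (by simp; linarith)
    simpa [neg_div] using this
  refine ⟨hInt, ?_⟩
  have hinner : ∀ x : EuclideanSpace ℝ (Fin n),
      ∫ t in Set.Ioi (0 : ℝ), t ^ (s - 1) * rexp (-((1 + ‖x‖ ^ 2) * t)) =
        (1 + ‖x‖ ^ 2) ^ (-s) * Gamma s := by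
    intro x
    rw [Real.integral_rpow_mul_exp_neg_mul_Ioi hs0 (hb x), one_div, Real.inv_rpow (hb x).le,
      Real.rpow_neg (hb x).le]
  have hprod : Integrable (Function.uncurry fun (x : EuclideanSpace ℝ (Fin n)) (t : ℝ) =>
      t ^ (s - 1) * rexp (-((1 + ‖x‖ ^ 2) * t))) (volume.prod (volume.restrict (Set.Ioi 0))) := by
    rw [integrable_prod_iff]
    · constructor
      · refine Filter.Eventually.of_forall fun x => ?_
        have := integrableOn_rpow_mul_exp_neg_mul_rpow (p := 1) (s := s - 1) (b := 1 + ‖x‖ ^ 2)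
          (by linarith) zero_lt_one (hb x)
        simpa only [IntegrableOn, Real.rpow_one, neg_mul, Function.uncurry_apply_pair] using this
      · refine (hInt.mul_const (Gamma s)).congr (Filter.Eventually.of_forall fun x => ?_)
        simp only [Function.uncurry]
        rw [← hinner x]
        refine setIntegral_congr_fun measurableSet_Ioi fun t ht => ?_
        have : 0 < t := ht
        rw [Real.norm_of_nonneg (by positivity)]
    · refine Measurable.aestronglyMeasurable ?_
      simp only [Function.uncurry_def]
      fun_prop
  have hswap := integral_integral_swap hprod
  simp only [hinner] at hswap
  rw [integral_mul_const] at hswap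
  have hgauss : ∀ t ∈ Set.Ioi (0 : ℝ), ∫ x : EuclideanSpace ℝ (Fin n),
      t ^ (s - 1) * rexp (-((1 + ‖x‖ ^ 2) * t)) =
      π ^ ((n : ℝ) / 2) * (t ^ (s - n / 2 - 1) * rexp (-(1 * t))) := by
    intro t ht
    have ht : 0 < t := ht
    have h := GaussianFourier.integral_rexp_neg_mul_sq_norm (V := EuclideanSpace ℝ (Fin n)) ht
    have e : ∀ x : EuclideanSpace ℝ (Fin n), t ^ (s - 1) * rexp (-((1 + ‖x‖ ^ 2) * t)) =
        t ^ (s - 1) * rexp (-(1 * t)) * rexp (-t * ‖x‖ ^ 2) := by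
      intro x
      rw [mul_assoc, ← Real.exp_add]; ring_nf
    simp only [e]
    rw [integral_const_mul, h, finrank_euclideanSpace_fin, Real.div_rpow pi_pos.le ht.le,
      show s - n / 2 - 1 = (s - 1) - n / 2 by ring, Real.rpow_sub ht (s - 1) ((n : ℝ) / 2)]
    ring
  rw [setIntegral_congr_fun measurableSet_Ioi hgauss, integral_const_mul,
    Real.integral_rpow_mul_exp_neg_mul_Ioi (by linarith) one_pos] at hswap
  rw [eq_div_iff hG.ne', hswap]
  simp

theorem integral_one_add_sum_sq_pow {n : ℕ} {k : ℕ} (hk0 : 0 < k) (hk : (n : ℝ) / 2 < k) :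
    Integrable (fun y : Fin n → ℝ => ((1 + ∑ i, y i ^ 2) ^ k)⁻¹) ∧
    ∫ y : Fin n → ℝ, ((1 + ∑ i, y i ^ 2) ^ k)⁻¹ =
      π ^ ((n : ℝ) / 2) * Gamma (k - n / 2) / Gamma k := by
  obtain ⟨h1, h2⟩ := integral_rpow_one_add_norm_sq (n := n) (s := k) (by exact_mod_cast hk0) hk
  have e : (fun x : EuclideanSpace ℝ (Fin n) => (1 + ‖x‖ ^ 2) ^ (-(k : ℝ))) =
      (fun y : Fin n → ℝ => ((1 + ∑ i, y i ^ 2) ^ k)⁻¹) ∘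
        (MeasurableEquiv.toLp 2 (Fin n → ℝ)).symm := by
    ext x
    rw [Real.rpow_neg (by positivity), Real.rpow_natCast, EuclideanSpace.real_norm_sq_eq]
    rfl
  have mp := EuclideanSpace.volume_preserving_symm_measurableEquiv_toLp (Fin n)
  rw [e] at h1 h2
  refine ⟨(mp.integrable_comp_emb (MeasurableEquiv.measurableEmbedding _)).1 h1, ?_⟩
  rw [← h2]
  exact (mp.integral_comp (MeasurableEquiv.measurableEmbedding _) _).symm

theorem integral_bubble {n : ℕ} (hn : 3 ≤ n) :
    Integrable (fun y : Fin n → ℝ => ((1 + ∑ i, y i ^ 2) ^ n)⁻¹) ∧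
    ∫ y : Fin n → ℝ, ((1 + ∑ i, y i ^ 2) ^ n)⁻¹ =
      π ^ ((n : ℝ) / 2) * (Gamma ((n : ℝ) / 2) / Gamma n) ∧
    Integrable (fun y : Fin n → ℝ => ((1 + ∑ i, y i ^ 2) ^ n)⁻¹ * ∑ i, y i ^ 2) ∧
    ∫ y : Fin n → ℝ, ((1 + ∑ i, y i ^ 2) ^ n)⁻¹ * ∑ i, y i ^ 2 =
      n / (n - 2) * (π ^ ((n : ℝ) / 2) * (Gamma ((n : ℝ) / 2) / Gamma n)) := by
  have hn3 : (3 : ℝ) ≤ n := by exact_mod_cast hn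
  obtain ⟨h1, h2⟩ := integral_one_add_sum_sq_pow (n := n) (k := n) (by omega) (by linarith)
  have hc : ((n - 1 : ℕ) : ℝ) = n - 1 := by push_cast [show 1 ≤ n by omega]; ring
  obtain ⟨h3, h4⟩ := integral_one_add_sum_sq_pow (n := n) (k := n - 1) (by omega)
    (by rw [hc]; linarith)
  have e : (fun y : Fin n → ℝ => ((1 + ∑ i, y i ^ 2) ^ n)⁻¹ * ∑ i, y i ^ 2) =
      fun y => ((1 + ∑ i, y i ^ 2) ^ (n - 1))⁻¹ - ((1 + ∑ i, y i ^ 2) ^ n)⁻¹ := by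
    ext y
    have hb : 0 < 1 + ∑ i, y i ^ 2 :=
      add_pos_of_pos_of_nonneg one_pos (Finset.sum_nonneg fun i _ => sq_nonneg _)
    have : (1 + ∑ i, y i ^ 2) ^ n = (1 + ∑ i, y i ^ 2) ^ (n - 1) * (1 + ∑ i, y i ^ 2) := by
      rw [← pow_succ]; congr 1; omega
    rw [this]
    field_simp
    ring
  rw [e]
  have h2' : ∫ y : Fin n → ℝ, ((1 + ∑ i, y i ^ 2) ^ n)⁻¹ =
      π ^ ((n : ℝ) / 2) * (Gamma ((n : ℝ) / 2) / Gamma n) := by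
    rw [h2, show (n : ℝ) - n / 2 = n / 2 by ring]; ring
  refine ⟨h1, h2', h3.sub h1, ?_⟩
  rw [integral_sub h3 h1, h2', h4, hc]
  have g1 : Gamma ((n : ℝ) / 2) = (n / 2 - 1) * Gamma (n / 2 - 1) := by
    rw [← Gamma_add_one (by linarith)]; congr 1; ring
  have g2 : Gamma (n : ℝ) = (n - 1) * Gamma (n - 1) := by
    rw [← Gamma_add_one (by linarith)]; congr 1; ring
  rw [g1, g2, show (n : ℝ) - 1 - n / 2 = n / 2 - 1 by ring]
  have hG1 : Gamma ((n : ℝ) - 1) ≠ 0 := (Gamma_pos_of_pos (by linarith)).ne'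
  have a1 : (n : ℝ) - 1 ≠ 0 := by linarith
  have a2 : (n : ℝ) - 2 ≠ 0 := by linarith
  field_simp
  ring

theorem tendsto_setIntegral_cube {n : ℕ} {f : (Fin n → ℝ) → ℝ} (hf : Integrable f) :
    Filter.Tendsto (fun k : ℕ => ∫ y in cube n k, f y) Filter.atTop (nhds (∫ y, f y)) := by
  have hU : (⋃ k : ℕ, cube n k) = Set.univ := by
    refine Set.eq_univ_of_forall fun x => ?_
    obtain ⟨k, hk⟩ := exists_nat_ge ‖x‖
    refine Set.mem_iUnion.2 ⟨k, ?_⟩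
    constructor <;> intro i
    · have := norm_le_pi_norm x i
      rw [Real.norm_eq_abs] at this
      have := neg_abs_le (x i)
      simp only
      linarith
    · have := norm_le_pi_norm x i
      rw [Real.norm_eq_abs] at this
      have := le_abs_self (x i)
      simp only
      linarith
  have := tendsto_setIntegral_of_monotone (μ := volume) (s := fun k : ℕ => cube n k) (f := f)
    (fun k => measurableSet_Icc) (fun a b hab => by
      have : (a : ℝ) ≤ b := by exact_mod_cast hab
      exact Set.Icc_subset_Icc (fun i => by simpa using this) (fun i => by simpa using this))
    (by rw [hU]; exact hf.integrableOn)
  rwa [hU, setIntegral_univ] at this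

theorem sobolev_cube_limit {n : ℕ} (hn : 3 ≤ n) {u : (Fin n → ℝ) → ℝ} (hu : ContDiff ℝ 1 u)
    {L R μ : ℝ} (hL : 0 < L) (hR : 0 < R) (hμ : 0 < μ)
    (hsupp : ∀ x, (∃ i, |x i| = L) → u x = 0) {I K N : ℝ}
    (hI : I = ∫ y in cube n R, ((1 + ∑ i, y i ^ 2) ^ n)⁻¹)
    (hK : K = ∫ y in cube n R, ((1 + ∑ i, y i ^ 2) ^ n)⁻¹ * ∑ i, y i ^ 2) (hI0 : 0 < I)
    (hN0 : 0 < N) (hN : N = ∫ x in cube n L, |u x| ^ (2 * (n : ℝ) / (n - 2))) :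
    n * (I + K) ≤ ((n : ℝ) - 1) / (n - 2) * (I / N) ^ (1 / 2 - 1 / (n : ℝ)) *
      (μ * (∫ x in cube n L, ∑ i, (fderiv ℝ u x (Pi.single i 1)) ^ 2) + K / μ) := by
  have hn3 : (3 : ℝ) ≤ n := by exact_mod_cast hn
  have hp : 0 ≤ (n : ℝ) / (n - 2) := div_nonneg (by linarith) (by linarith)
  have hq : 0 < ((n : ℝ) - 1) / (n - 2) := div_pos (by linarith) (by linarith)
  set J : ℝ → ℝ := fun ε => ∫ x in cube n L, (u x ^ 2 + ε ^ 2) ^ ((n : ℝ) / (n - 2)) with hJ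
  have hJc : Continuous J := by
    refine continuous_parametric_integral_of_continuous (s := cube n L)
      (f := fun ε x => (u x ^ 2 + ε ^ 2) ^ ((n : ℝ) / (n - 2))) ?_ isCompact_Icc
    have := hu.continuous
    refine Continuous.rpow_const ?_ (fun _ => Or.inr hp)
    fun_prop
  have hJ0 : J 0 = N := by
    rw [hN, hJ]
    refine setIntegral_congr_fun measurableSet_Icc fun x _ => ?_
    rw [zero_pow two_ne_zero, add_zero, ← sq_abs, ← Real.rpow_natCast, ← Real.rpow_mul (abs_nonneg _)]
    congr 1
    push_cast
    ring
  have hl : ContinuousAt (fun ε => I / J ε) 0 :=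
    continuousAt_const.div hJc.continuousAt (by rw [hJ0]; exact hN0.ne')
  have hl0 : I / J 0 ≠ 0 := by rw [hJ0]; positivity
  have hcont : ContinuousAt (fun ε => (I / J ε) ^ (1 - 1 / (n : ℝ)) *
      (n * ((ε ^ 2) ^ (((n : ℝ) - 1) / (n - 2)) * (2 * R) * volume.real (cube (n - 1) L))) +
      ((n : ℝ) - 1) / (n - 2) * (I / J ε) ^ (1 / 2 - 1 / (n : ℝ)) *
      (μ * (∫ x in cube n L, ∑ i, (fderiv ℝ u x (Pi.single i 1)) ^ 2) + K / μ)) 0 := by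
    refine ContinuousAt.add (ContinuousAt.mul (hl.rpow_const (Or.inl hl0)) ?_) ?_
    · have : ContinuousAt (fun ε : ℝ => (ε ^ 2) ^ (((n : ℝ) - 1) / (n - 2))) 0 :=
        (by fun_prop : ContinuousAt (fun ε : ℝ => ε ^ 2) 0).rpow_const (Or.inr hq.le)
      fun_prop
    · exact ((continuousAt_const).mul (hl.rpow_const (Or.inl hl0))).mul continuousAt_const
  have hlim := hcont.tendsto.mono_left (nhdsWithin_le_nhds (s := Set.Ioi 0))
  have hev : ∀ᶠ ε in nhdsWithin (0 : ℝ) (Set.Ioi 0), 0 < J ε :=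
    (hJc.continuousAt.eventually (lt_mem_nhds (by rw [hJ0]; exact hN0))).filter_mono
      nhdsWithin_le_nhds
  have key := ge_of_tendsto hlim (b := n * (I + K)) (by
    filter_upwards [hev, self_mem_nhdsWithin] with ε h1 h2
    exact sobolev_cube_aux hn hu hL hR h2 hμ hsupp hI hK (div_pos hI0 h1)
      (div_mul_cancel₀ I h1.ne'))
  rw [hJ0] at key
  simpa [Real.zero_rpow hq.ne'] using key

theorem sobolev_pi {n : ℕ} (hn : 3 ≤ n) {u : (Fin n → ℝ) → ℝ} (hu : ContDiff ℝ 1 u)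
    (hc : HasCompactSupport u) :
    sobolevConst n * (∫ x, |u x| ^ (2 * (n : ℝ) / (n - 2))) ^ (((n : ℝ) - 2) / n) ≤
      ∫ x, ∑ i, (fderiv ℝ u x (Pi.single i 1)) ^ 2 := by
  have hn3 : (3 : ℝ) ≤ n := by exact_mod_cast hn
  have hp0 : 0 < 2 * (n : ℝ) / (n - 2) := div_pos (by linarith) (by linarith)
  set E := ∫ x, ∑ i, (fderiv ℝ u x (Pi.single i 1)) ^ 2 with hE
  have hE0 : 0 ≤ E := integral_nonneg fun x => Finset.sum_nonneg fun i _ => sq_nonneg _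
  set N := ∫ x, |u x| ^ (2 * (n : ℝ) / (n - 2)) with hNdef
  have hN0 : 0 ≤ N := integral_nonneg fun x => by positivity
  rcases hN0.eq_or_lt with h0 | hN0
  · rw [← h0, Real.zero_rpow (div_pos (by linarith) (by linarith)).ne', mul_zero]
    exact hE0
  obtain ⟨r, hr⟩ := hc.isCompact.isBounded.subset_closedBall 0
  set L := max r 0 + 1 with hLdef
  have hL : 0 < L := by positivity
  have hz : ∀ x : Fin n → ℝ, (∃ i, L ≤ |x i|) → u x = 0 := by
    rintro x ⟨i, hi⟩
    by_contra hx
    have h1 := hr (subset_tsupport _ hx)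
    rw [mem_closedBall_zero_iff] at h1
    have h2 := norm_le_pi_norm x i
    rw [Real.norm_eq_abs] at h2
    have := le_max_left r 0
    linarith
  have hNL : N = ∫ x in cube n L, |u x| ^ (2 * (n : ℝ) / (n - 2)) := by
    refine (setIntegral_eq_integral_of_forall_compl_eq_zero fun x hx => ?_).symm
    have : u x = 0 := by
      apply hz
      by_contra! h
      exact hx ⟨fun i => (abs_lt.1 (h i)).1.le, fun i => (abs_lt.1 (h i)).2.le⟩
    rw [this, abs_zero, Real.zero_rpow hp0.ne']
  have hEi : Integrable fun x => ∑ i, (fderiv ℝ u x (Pi.single i 1)) ^ 2 := by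
    refine Continuous.integrable_of_hasCompactSupport ?_ ?_
    · have := hu.continuous_fderiv one_ne_zero
      fun_prop
    · refine (hc.fderiv ℝ).mono fun x hx => ?_
      contrapose! hx
      simp only [Function.mem_support, ne_eq, not_not] at hx ⊢
      simp [hx]
  have hEL : ∫ x in cube n L, ∑ i, (fderiv ℝ u x (Pi.single i 1)) ^ 2 ≤ E :=
    setIntegral_le_integral hEi
      (Filter.Eventually.of_forall fun x => Finset.sum_nonneg fun i _ => sq_nonneg _)
  obtain ⟨b1, b2, b3, b4⟩ := integral_bubble hn
  have hGpos : 0 < Gamma ((n : ℝ) / 2) / Gamma n :=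
    div_pos (Gamma_pos_of_pos (by linarith)) (Gamma_pos_of_pos (by linarith))
  set I := π ^ ((n : ℝ) / 2) * (Gamma ((n : ℝ) / 2) / Gamma n) with hIdef
  have hI0 : 0 < I := mul_pos (Real.rpow_pos_of_pos pi_pos _) hGpos
  have t1 := tendsto_setIntegral_cube b1
  have t2 := tendsto_setIntegral_cube b3
  rw [b2] at t1
  rw [b4] at t2
  set lam := (I / N) ^ (1 / 2 - 1 / (n : ℝ)) with hlam
  have hlam0 : 0 < lam := Real.rpow_pos_of_pos (div_pos hI0 hN0) _
  have hn2 : 0 < (n : ℝ) - 2 := by linarith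
  have key : ∀ μ : ℝ, 0 < μ → n * (I + n / (n - 2) * I) ≤ ((n : ℝ) - 1) / (n - 2) * lam *
      (μ * E + n / (n - 2) * I / μ) := by
    intro μ hμ
    refine le_of_tendsto_of_tendsto (t1.add t2 |>.const_mul (n : ℝ))
      (((((t1.div_const N).rpow_const (p := 1 / 2 - 1 / (n : ℝ))
        (Or.inl (div_pos hI0 hN0).ne')).const_mul (((n : ℝ) - 1) / (n - 2)))).mul
        ((t2.div_const μ).const_add (μ * E))) ?_
    filter_upwards [t1.eventually (lt_mem_nhds hI0), Filter.eventually_gt_atTop 0] with k hk1 hk2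
    refine (sobolev_cube_limit hn hu hL (R := k) (by exact_mod_cast hk2) hμ
      (fun x ⟨i, hi⟩ => hz x ⟨i, hi.ge⟩) rfl rfl hk1 hN0 hNL).trans ?_
    have : 0 < ((n : ℝ) - 1) / (n - 2) := div_pos (by linarith) hn2
    gcongr
  have h1 := key (lam / (n - 2)) (div_pos hlam0 hn2)
  have h2 : n * (n - 2) * I ≤ lam ^ 2 * E := by
    have e1 : n * (I + n / ((n : ℝ) - 2) * I) = ((n : ℝ) - 1) / (n - 2) * (2 * n * I) := by
      field_simp; ring
    have e2 : ((n : ℝ) - 1) / (n - 2) * lam * (lam / (n - 2) * E + n / (n - 2) * I /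
        (lam / (n - 2))) = ((n : ℝ) - 1) / (n - 2) * (lam ^ 2 * E / (n - 2) + n * I) := by
      field_simp
    rw [e1, e2] at h1
    have h3 := le_of_mul_le_mul_left h1 (div_pos (by linarith) hn2)
    have h4 : n * I ≤ lam ^ 2 * E / (n - 2) := by linarith
    rw [le_div_iff₀ hn2] at h4
    linarith
  have hlam2 : lam ^ 2 = (I / N) ^ (((n : ℝ) - 2) / n) := by
    rw [hlam, ← Real.rpow_natCast, ← Real.rpow_mul (div_pos hI0 hN0).le]
    congr 1
    field_simp
    push_cast
    ring
  rw [hlam2, Real.div_rpow hI0.le hN0.le] at h2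
  have hNp : 0 < N ^ (((n : ℝ) - 2) / n) := Real.rpow_pos_of_pos hN0 _
  have hIp : 0 < I ^ (((n : ℝ) - 2) / n) := Real.rpow_pos_of_pos hI0 _
  have hI2 : I = I ^ (((n : ℝ) - 2) / n) * (π * (Gamma ((n : ℝ) / 2) / Gamma n) ^ (2 / (n : ℝ))) := by
    have : π * (Gamma ((n : ℝ) / 2) / Gamma n) ^ (2 / (n : ℝ)) = I ^ (2 / (n : ℝ)) := by
      rw [hIdef, Real.mul_rpow (Real.rpow_nonneg pi_pos.le _) hGpos.le, ← Real.rpow_mul pi_pos.le,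
        show (n : ℝ) / 2 * (2 / n) = 1 by field_simp, Real.rpow_one]
    rw [this, ← Real.rpow_add hI0, show ((n : ℝ) - 2) / n + 2 / n = 1 by field_simp; ring,
      Real.rpow_one]
  rw [div_mul_eq_mul_div, le_div_iff₀ hNp] at h2
  rw [sobolevConst]
  refine le_of_mul_le_mul_left (le_trans (le_of_eq ?_) h2) hIp
  conv_rhs => rw [hI2]
  ring

theorem sobolev_euclidean {n : ℕ} (hn : 3 ≤ n) {u : EuclideanSpace ℝ (Fin n) → ℝ}
    (hu : ContDiff ℝ 1 u) (hc : HasCompactSupport u) :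
    sobolevConst n * (∫ x, |u x| ^ (2 * (n : ℝ) / (n - 2))) ^ (((n : ℝ) - 2) / n) ≤
      ∫ x, ‖gradient u x‖ ^ 2 := by
  set e := (PiLp.continuousLinearEquiv 2 ℝ (fun _ : Fin n => ℝ)).symm with he
  have mp := (EuclideanSpace.volume_preserving_symm_measurableEquiv_toLp (Fin n)).symm
  have h := sobolev_pi hn (u := u ∘ e) (hu.comp e.contDiff)
    (hc.comp_homeomorph e.toHomeomorph)
  have h1 : ∫ x, |(u ∘ e) x| ^ (2 * (n : ℝ) / (n - 2)) = ∫ x, |u x| ^ (2 * (n : ℝ) / (n - 2)) :=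
    mp.integral_comp (MeasurableEquiv.measurableEmbedding _)
      (fun x => |u x| ^ (2 * (n : ℝ) / (n - 2)))
  have h2 : ∫ x, ∑ i, (fderiv ℝ (u ∘ e) x (Pi.single i 1)) ^ 2 = ∫ x, ‖gradient u x‖ ^ 2 := by
    rw [← mp.integral_comp (MeasurableEquiv.measurableEmbedding _)]
    refine integral_congr_ae (Filter.Eventually.of_forall fun x => ?_)
    have hd : DifferentiableAt ℝ u (e x) := hu.differentiable one_ne_zero _
    change _ = ‖gradient u (e x)‖ ^ 2
    rw [EuclideanSpace.real_norm_sq_eq]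
    refine Finset.sum_congr rfl fun i _ => ?_
    rw [fderiv_comp x hd e.differentiableAt, e.fderiv]
    have : (e : (Fin n → ℝ) →L[ℝ] EuclideanSpace ℝ (Fin n)) (Pi.single i 1) =
        EuclideanSpace.single i 1 := rfl
    rw [ContinuousLinearMap.comp_apply, this, ← inner_gradient_left,
      EuclideanSpace.inner_single_right]
    simp
  rwa [h1, h2] at h

theorem integral_annulus_eq {E : Type*} [NormedAddCommGroup E] [NormedSpace ℝ E] [Nontrivial E]
    [FiniteDimensional ℝ E] [MeasurableSpace E] [BorelSpace E] {μ : Measure E}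
    [μ.IsAddHaarMeasure] {n : ℕ} (hn : Module.finrank ℝ E = n) {f : E → ℝ}
    (hf : Integrable f μ) {r₁ r₂ : ℝ} (h1 : 0 < r₁) (h12 : r₁ ≤ r₂)
    (hz1 : ∀ x, ‖x‖ < r₁ → f x = 0) (hz2 : ∀ x, r₂ < ‖x‖ → f x = 0) :
    Integrable (fun θ : Metric.sphere (0 : E) 1 =>
      ∫ r in r₁..r₂, r ^ (n - 1) * f (r • (θ : E))) μ.toSphere ∧
    ∫ x, f x ∂μ = ∫ θ : Metric.sphere (0 : E) 1,
      (∫ r in r₁..r₂, r ^ (n - 1) * f (r • (θ : E))) ∂μ.toSphere := by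
  have hray : ∀ θ : Metric.sphere (0 : E) 1,
      ∫ r : Set.Ioi (0 : ℝ), f (r.1 • (θ : E)) ∂.volumeIoiPow (n - 1) =
        ∫ r in r₁..r₂, r ^ (n - 1) * f (r • (θ : E)) := by
    intro θ
    have hθ : ‖(θ : E)‖ = 1 := norm_eq_of_mem_sphere θ
    simp only [Measure.volumeIoiPow, ENNReal.ofReal]
    rw [integral_withDensity_eq_integral_smul,
      integral_subtype_comap measurableSet_Ioi
        fun a ↦ Real.toNNReal (a ^ (n - 1)) • f (a • (θ : E)),
      setIntegral_congr_fun (g := fun a => a ^ (n - 1) * f (a • (θ : E)))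
        measurableSet_Ioi fun x hx ↦ ?_, intervalIntegral.integral_of_le h12,
      ← integral_Icc_eq_integral_Ioc]
    · refine setIntegral_eq_of_subset_of_forall_sdiff_eq_zero measurableSet_Ioi
        (fun x hx => h1.trans_le hx.1) fun x hx => ?_
      have hx0 : 0 < x := hx.1
      have hx1 : ‖x • (θ : E)‖ = x := by
        rw [norm_smul, hθ, mul_one, Real.norm_of_nonneg hx0.le]
      have : f (x • (θ : E)) = 0 := by
        by_cases h : x < r₁
        · exact hz1 _ (by rwa [hx1])
        · refine hz2 _ ?_
          rw [hx1]
          by_contra! h'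
          exact hx.2 ⟨not_lt.1 h, h'⟩
      rw [this, mul_zero]
    · simp only [NNReal.smul_def, smul_eq_mul]
      rw [Real.coe_toNNReal _ (pow_nonneg (le_of_lt hx) _)]
    · exact (measurable_subtype_coe.pow_const _).real_toNNReal
  have mp := μ.measurePreserving_homeomorphUnitSphereProd
  rw [hn] at mp
  set F : Metric.sphere (0 : E) 1 × Set.Ioi (0 : ℝ) → ℝ := fun p => f (p.2.1 • (p.1 : E)) with hF
  have hFf : F ∘ homeomorphUnitSphereProd E = fun x => f x.1 := by
    ext x
    have hx : ‖x.1‖ ≠ 0 := norm_ne_zero_iff.2 x.2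
    simp [hF, smul_smul, hx]
  have hi1 : Integrable (F ∘ homeomorphUnitSphereProd E) (μ.comap Subtype.val) := by
    rw [hFf]
    exact (integrableOn_iff_comap_subtypeVal (measurableSet_singleton _).compl).1 hf.integrableOn
  have hi2 : Integrable F _ :=
    (mp.integrable_comp_emb (Homeomorph.measurableEmbedding _)).1 hi1
  have e1 : ∫ x, f x ∂μ = ∫ p, F p ∂(μ.toSphere.prod (.volumeIoiPow (n - 1))) := by
    rw [← mp.integral_comp (Homeomorph.measurableEmbedding _)]
    have : ∀ x, F (homeomorphUnitSphereProd E x) = f x.1 := fun x => congrFun hFf x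
    simp only [this]
    rw [integral_subtype_comap (measurableSet_singleton _).compl f, restrict_compl_singleton]
  have hi3 := hi2.integral_prod_left
  simp only [hF, hray] at hi3
  refine ⟨hi3, ?_⟩
  rw [e1, integral_prod _ hi2]
  simp only [hF, hray]

section RadialComposition

variable {E : Type*} [NormedAddCommGroup E] [InnerProductSpace ℝ E]

theorem hasFDerivAt_norm_smul_unit {θ : E} (hθ : ‖θ‖ = 1) {ρ : ℝ} (hρ : 0 < ρ) :
    HasFDerivAt (fun y : E => ‖y‖) (innerSL ℝ θ) (ρ • θ) := by
  have hn : ‖ρ • θ‖ = ρ := by rw [norm_smul, hθ, mul_one, Real.norm_of_nonneg hρ.le]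
  have h1 := (hasFDerivAt_id (𝕜 := ℝ) (ρ • θ)).norm_sq
  have h2 := h1.sqrt (by simp only [id]; rw [hn]; positivity)
  simp only [id, Real.sqrt_sq (norm_nonneg _), hn] at h2
  refine h2.congr_fderiv ?_
  ext v
  simp only [smul_apply, ContinuousLinearMap.comp_apply, smul_eq_mul,
    ContinuousLinearMap.id_apply, innerSL_apply_apply, inner_smul_left]
  rw [Real.sqrt_sq hρ.le]
  simp
  field_simp

variable [CompleteSpace E]

theorem hasGradientAt_radial_comp {u : E → ℝ} {ψ h : ℝ → ℝ} {ψ' h' ρ : ℝ} {θ : E}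
    (hθ : ‖θ‖ = 1) (hρ : 0 < ρ) (hu : DifferentiableAt ℝ u (h ρ • θ)) (hψ : HasDerivAt ψ ψ' ρ)
    (hh : HasDerivAt h h' ρ) :
    HasGradientAt (fun y => ψ ‖y‖ * u ((h ‖y‖ / ‖y‖) • y))
      ((ψ' * u (h ρ • θ) + ψ ρ * (h' - h ρ / ρ) * inner ℝ (gradient u (h ρ • θ)) θ) • θ +
        (ψ ρ * (h ρ / ρ)) • gradient u (h ρ • θ)) (ρ • θ) := by
  have hn : ‖ρ • θ‖ = ρ := by rw [norm_smul, hθ, mul_one, Real.norm_of_nonneg hρ.le]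
  have hN := hasFDerivAt_norm_smul_unit hθ hρ
  have h1 : HasFDerivAt (fun y : E => ψ ‖y‖) (ψ' • innerSL ℝ θ) (ρ • θ) :=
    HasDerivAt.comp_hasFDerivAt (h₂ := ψ) (ρ • θ) (by rw [hn]; exact hψ) hN
  have h2 : HasFDerivAt (fun y : E => h ‖y‖ / ‖y‖) (((h' * ρ - h ρ * 1) / ρ ^ 2) • innerSL ℝ θ)
      (ρ • θ) :=
    HasDerivAt.comp_hasFDerivAt (h₂ := fun r => h r / r) (ρ • θ)
      (by rw [hn]; exact hh.div (hasDerivAt_id ρ) hρ.ne') hN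
  have h3 := h2.smul (hasFDerivAt_id (𝕜 := ℝ) (ρ • θ))
  have hpt : (h ‖ρ • θ‖ / ‖ρ • θ‖) • (ρ • θ) = h ρ • θ := by
    rw [hn, smul_smul, div_mul_cancel₀ _ hρ.ne']
  have hpt' : (h ρ / ρ) • ρ • θ = h ρ • θ := by rw [← hpt, hn]
  have h4 := HasFDerivAt.comp (g := u) (f := fun y : E => (h ‖y‖ / ‖y‖) • y)
    (g' := fderiv ℝ u (h ρ • θ)) (ρ • θ) (by rw [hpt]; exact hu.hasFDerivAt) h3
  have h5 := h1.mul h4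
  rw [hasGradientAt_iff_hasFDerivAt]
  refine h5.congr_fderiv ?_
  ext v
  simp only [id, Function.comp_apply, hn, hpt', add_apply, smul_apply,
    ContinuousLinearMap.comp_apply, ContinuousLinearMap.smulRight_apply, smul_eq_mul,
    ContinuousLinearMap.id_apply, innerSL_apply_apply, InnerProductSpace.toDual_apply_apply,
    map_add, map_smul, ← inner_gradient_left]
  have : (h' * ρ - h ρ * 1) / ρ ^ 2 = (h' - h ρ / ρ) / ρ := by field_simp
  rw [this]
  field_simp
  ring

theorem norm_sq_gradient_radial_comp {u : E → ℝ} {ψ h : ℝ → ℝ} {ψ' h' ρ : ℝ} {θ : E}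
    (hθ : ‖θ‖ = 1) (hρ : 0 < ρ) (hu : DifferentiableAt ℝ u (h ρ • θ)) (hψ : HasDerivAt ψ ψ' ρ)
    (hh : HasDerivAt h h' ρ) :
    ‖gradient (fun y => ψ ‖y‖ * u ((h ‖y‖ / ‖y‖) • y)) (ρ • θ)‖ ^ 2 =
      (ψ' * u (h ρ • θ) + ψ ρ * h' * inner ℝ (gradient u (h ρ • θ)) θ) ^ 2 +
      (ψ ρ * h ρ / ρ) ^ 2 * (‖gradient u (h ρ • θ)‖ ^ 2 -
        inner ℝ (gradient u (h ρ • θ)) θ ^ 2) := by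
  rw [(hasGradientAt_radial_comp hθ hρ hu hψ hh).gradient, norm_add_sq_real, norm_smul, norm_smul,
    hθ, inner_smul_left, inner_smul_right, mul_one, mul_pow, Real.norm_eq_abs, Real.norm_eq_abs,
    sq_abs, sq_abs, real_inner_comm]
  simp only [conj_trivial]
  ring

end RadialComposition

/-- The radial profile `ρ ↦ D exp (a - ρ ^ (-κ))`. -/
noncomputable def radialProfile (D a κ ρ : ℝ) : ℝ := D * rexp (a - ρ ^ (-κ))

/-- The radial amplitude that makes the change of variables along `radialProfile` compatible
with the Dirichlet integral. -/
noncomputable def radialAmplitude (m : ℕ) (D a κ ρ : ℝ) : ℝ :=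
  √(radialProfile D a κ ρ ^ m / (ρ ^ m * (κ * ρ ^ (-κ))))

section Profile

variable {D a κ ρ : ℝ}

theorem radialProfile_pos (hD : 0 < D) : 0 < radialProfile D a κ ρ := by
  unfold radialProfile; positivity

theorem hasDerivAt_rpow_neg (hρ : 0 < ρ) :
    HasDerivAt (fun ρ : ℝ => ρ ^ (-κ)) (-(κ * ρ ^ (-κ) / ρ)) ρ := by
  convert Real.hasDerivAt_rpow_const (p := -κ) (Or.inl hρ.ne') using 1
  rw [Real.rpow_sub_one hρ.ne']
  ring

theorem hasDerivAt_radialProfile (hρ : 0 < ρ) :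
    HasDerivAt (radialProfile D a κ) (κ * ρ ^ (-κ) * radialProfile D a κ ρ / ρ) ρ := by
  have := (((hasDerivAt_rpow_neg (κ := κ) hρ).const_sub a).exp).const_mul D
  refine this.congr_deriv ?_
  unfold radialProfile
  ring

theorem radialAmplitude_pos (hD : 0 < D) (hκ : 0 < κ) (hρ : 0 < ρ) (m : ℕ) :
    0 < radialAmplitude m D a κ ρ := by
  have := radialProfile_pos (a := a) (κ := κ) (ρ := ρ) hD
  unfold radialAmplitude; positivity

theorem radialAmplitude_sq (hD : 0 < D) (hκ : 0 < κ) (hρ : 0 < ρ) (m : ℕ) :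
    radialAmplitude m D a κ ρ ^ 2 = radialProfile D a κ ρ ^ m / (ρ ^ m * (κ * ρ ^ (-κ))) := by
  have := radialProfile_pos (a := a) (κ := κ) (ρ := ρ) hD
  unfold radialAmplitude
  rw [Real.sq_sqrt (by positivity)]

theorem hasDerivAt_radialAmplitude (hD : 0 < D) (hκ : 0 < κ) (hρ : 0 < ρ) {m : ℕ} (hm : 1 ≤ m) :
    HasDerivAt (radialAmplitude m D a κ)
      (radialAmplitude m D a κ ρ * (m * (κ * ρ ^ (-κ)) - m + κ) / (2 * ρ)) ρ := by
  have hh := radialProfile_pos (a := a) (κ := κ) (ρ := ρ) hD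
  have hw : 0 < ρ ^ (-κ) := Real.rpow_pos_of_pos hρ _
  have hψ := radialAmplitude_pos (a := a) hD hκ hρ m
  have hsq := radialAmplitude_sq (a := a) hD hκ hρ m
  have h1 := (hasDerivAt_radialProfile (D := D) (a := a) (κ := κ) hρ).pow m
  have h2 := (hasDerivAt_pow m ρ).mul ((hasDerivAt_rpow_neg (κ := κ) hρ).const_mul κ)
  have h3 := (h1.div h2 (by simp only [Pi.mul_apply]; positivity)).sqrt
    (by simp only [Pi.div_apply, Pi.pow_apply, Pi.mul_apply]; positivity)
  refine h3.congr_deriv ?_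
  simp only [Pi.div_apply, Pi.pow_apply, Pi.mul_apply]
  change _ / (2 * radialAmplitude m D a κ ρ) = _
  rw [div_eq_iff (by positivity), show radialAmplitude m D a κ ρ *
    (m * (κ * ρ ^ (-κ)) - m + κ) / (2 * ρ) * (2 * radialAmplitude m D a κ ρ) =
    radialAmplitude m D a κ ρ ^ 2 * ((m * (κ * ρ ^ (-κ)) - m + κ) / ρ) by field_simp, hsq]
  obtain ⟨k, rfl⟩ : ∃ k, m = k + 1 := ⟨m - 1, by omega⟩
  generalize radialProfile D a κ ρ = h at *
  generalize ρ ^ (-κ) = w at *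
  simp only [Nat.add_sub_cancel]
  rw [pow_succ h k, pow_succ ρ k]
  field_simp
  ring

end Profile

theorem radial_hardy_energy_le {D a κ : ℝ} (hD : 0 < D) (hκ : 0 < κ) {m : ℕ} (hm : 1 ≤ m)
    (hmκ : m ≤ κ) {ρa ρb : ℝ} (ha : 0 < ρa) (hab : ρa ≤ ρb)
    (hb : ∀ ρ ∈ Set.Icc ρa ρb, 1 ≤ κ * ρ ^ (-κ)) {g g' T : ℝ → ℝ}
    (hg : ∀ r, HasDerivAt g (g' r) r) (hg' : Continuous g') (hT : Continuous T)
    (hT0 : ∀ r, 0 ≤ T r) (hga : g (radialProfile D a κ ρa) = 0)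
    (hgb : g (radialProfile D a κ ρb) = 0) :
    ∫ ρ in ρa..ρb, ρ ^ (m + 1) *
      ((radialAmplitude m D a κ ρ * (m * (κ * ρ ^ (-κ)) - m + κ) / (2 * ρ) *
          g (radialProfile D a κ ρ) +
        radialAmplitude m D a κ ρ * (κ * ρ ^ (-κ) * radialProfile D a κ ρ / ρ) *
          g' (radialProfile D a κ ρ)) ^ 2 +
      (radialAmplitude m D a κ ρ * radialProfile D a κ ρ / ρ) ^ 2 * T (radialProfile D a κ ρ)) ≤
    ∫ r in radialProfile D a κ ρa..radialProfile D a κ ρb, r ^ (m + 1) *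
      (g' r ^ 2 + T r - (m / 2) ^ 2 * (g r ^ 2 / r ^ 2)) := by
  have hpos : ∀ ρ ∈ Set.uIcc ρa ρb, 0 < ρ := fun ρ hρ => by
    rw [Set.uIcc_of_le hab] at hρ; exact ha.trans_le hρ.1
  have hhpos : ∀ ρ, 0 < radialProfile D a κ ρ := fun ρ => radialProfile_pos hD
  have hgc : Continuous g := continuous_iff_continuousAt.2 fun r => (hg r).continuousAt
  have cw : ContinuousOn (fun ρ : ℝ => ρ ^ (-κ)) (Set.uIcc ρa ρb) := fun ρ hρ =>
    (hasDerivAt_rpow_neg (hpos ρ hρ)).continuousAt.continuousWithinAt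
  have ch : ContinuousOn (radialProfile D a κ) (Set.uIcc ρa ρb) := fun ρ hρ =>
    (hasDerivAt_radialProfile (hpos ρ hρ)).continuousAt.continuousWithinAt
  have cψ : ContinuousOn (radialAmplitude m D a κ) (Set.uIcc ρa ρb) := fun ρ hρ =>
    (hasDerivAt_radialAmplitude hD hκ (hpos ρ hρ) hm).continuousAt.continuousWithinAt
  have ch' : ContinuousOn (fun ρ => κ * ρ ^ (-κ) * radialProfile D a κ ρ / ρ)
      (Set.uIcc ρa ρb) :=
    ((continuousOn_const.mul cw).mul ch).div continuousOn_id fun ρ hρ => (hpos ρ hρ).ne'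
  have cg : ContinuousOn (fun ρ => g (radialProfile D a κ ρ)) (Set.uIcc ρa ρb) :=
    hgc.comp_continuousOn ch
  have cg' : ContinuousOn (fun ρ => g' (radialProfile D a κ ρ)) (Set.uIcc ρa ρb) :=
    hg'.comp_continuousOn ch
  have cT : ContinuousOn (fun ρ => T (radialProfile D a κ ρ)) (Set.uIcc ρa ρb) :=
    hT.comp_continuousOn ch
  have hne : ∀ ρ ∈ Set.uIcc ρa ρb, ρ ≠ 0 := fun ρ hρ => (hpos ρ hρ).ne'
  have hcv := intervalIntegral.integral_comp_mul_deriv' (a := ρa) (b := ρb)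
    (f := radialProfile D a κ)
    (f' := fun ρ => κ * ρ ^ (-κ) * radialProfile D a κ ρ / ρ)
    (g := fun r => r ^ (m + 1) * (g' r ^ 2 + T r - (m / 2) ^ 2 * (g r ^ 2 / r ^ 2)))
    (fun ρ hρ => hasDerivAt_radialProfile (hpos ρ hρ)) ch' (by
      rintro r ⟨ρ, hρ, rfl⟩
      have := (hhpos ρ).ne'
      refine ContinuousAt.continuousWithinAt ?_
      fun_prop (disch := positivity))
  set A : ℝ → ℝ := fun ρ => radialProfile D a κ ρ ^ m * ((κ - m) / (2 * (κ * ρ ^ (-κ))) + m / 2)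
    with hA
  set Z : ℝ → ℝ := fun ρ =>
    2 * g (radialProfile D a κ ρ) * (g' (radialProfile D a κ ρ) *
      (κ * ρ ^ (-κ) * radialProfile D a κ ρ / ρ)) * A ρ +
    g (radialProfile D a κ ρ) ^ 2 * (radialProfile D a κ ρ ^ m / ρ *
      (m * ((κ - m) / 2 + m / 2 * (κ * ρ ^ (-κ))) + (κ - m) / (2 * ρ ^ (-κ)))) with hZ
  have hderiv : ∀ ρ ∈ Set.uIcc ρa ρb,
      HasDerivAt (fun ρ => g (radialProfile D a κ ρ) ^ 2 * A ρ) (Z ρ) ρ := by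
    intro ρ hρ
    have hρ0 := hpos ρ hρ
    have hw : 0 < ρ ^ (-κ) := Real.rpow_pos_of_pos hρ0 _
    have d1 := hasDerivAt_radialProfile (D := D) (a := a) (κ := κ) hρ0
    have d2 := (((hg (radialProfile D a κ ρ)).comp ρ d1).pow 2)
    have d3 := (d1.pow m).mul ((((((hasDerivAt_rpow_neg (κ := κ) hρ0).const_mul κ).const_mul
      2).fun_inv (by positivity)).const_mul (κ - m)).add_const ((m : ℝ) / 2))
    have d4 := d2.mul d3
    refine d4.congr_deriv ?_
    simp only [hZ, hA, Pi.pow_apply, Function.comp_apply, Pi.mul_apply]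
    have := hhpos ρ
    obtain ⟨k, rfl⟩ : ∃ k, m = k + 1 := ⟨m - 1, by omega⟩
    generalize radialProfile D a κ ρ = h at *
    generalize ρ ^ (-κ) = w at *
    simp only [Nat.add_sub_cancel]
    rw [pow_succ h k]
    field_simp
    ring
  have cZ : ContinuousOn Z (Set.uIcc ρa ρb) := by
    have hw : ∀ ρ ∈ Set.uIcc ρa ρb, ρ ^ (-κ) ≠ 0 := fun ρ hρ =>
      (Real.rpow_pos_of_pos (hpos ρ hρ) _).ne'
    have hw2 : ∀ ρ ∈ Set.uIcc ρa ρb, 2 * (κ * ρ ^ (-κ)) ≠ 0 := fun ρ hρ => by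
      have := hw ρ hρ; positivity
    have hw3 : ∀ ρ ∈ Set.uIcc ρa ρb, 2 * ρ ^ (-κ) ≠ 0 := fun ρ hρ => by
      have := hw ρ hρ; positivity
    simp only [hZ, hA]
    fun_prop (disch := assumption)
  have hZ0 : ∫ ρ in ρa..ρb, Z ρ = 0 := by
    rw [intervalIntegral.integral_eq_sub_of_hasDerivAt hderiv cZ.intervalIntegrable, hga, hgb]
    ring
  rw [← hcv]
  refine le_of_le_of_eq ?_ (add_zero _)
  rw [← hZ0, ← intervalIntegral.integral_add _
    cZ.intervalIntegrable]
  · refine intervalIntegral.integral_mono_on hab ?_ ?_ ?_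
    · refine ContinuousOn.intervalIntegrable ?_
      have hne2 : ∀ ρ ∈ Set.uIcc ρa ρb, 2 * ρ ≠ 0 := fun ρ hρ => by
        have := hne ρ hρ; positivity
      fun_prop (disch := assumption)
    · refine ContinuousOn.intervalIntegrable ?_
      have : ∀ ρ ∈ Set.uIcc ρa ρb, radialProfile D a κ ρ ^ 2 ≠ 0 := fun ρ _ =>
        (pow_pos (hhpos ρ) 2).ne'
      simp only [Function.comp_apply]
      fun_prop (disch := assumption)
    · intro ρ hρ
      have hκw := hb ρ hρ
      have hρ0 : 0 < ρ := ha.trans_le hρ.1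
      have hw : 0 < ρ ^ (-κ) := Real.rpow_pos_of_pos hρ0 _
      have hsq := radialAmplitude_sq (a := a) hD hκ hρ0 m
      have hh := hhpos ρ
      have hTρ := hT0 (radialProfile D a κ ρ)
      simp only [Function.comp_apply, hZ, hA]
      generalize radialProfile D a κ ρ = h at *
      generalize ρ ^ (-κ) = w at *
      generalize radialAmplitude m D a κ ρ = ψ at *
      generalize g h = Q at *
      generalize g' h = G at *
      generalize T h = t at *
      have e1 : ρ ^ (m + 1) * ((ψ * (m * (κ * w) - m + κ) / (2 * ρ) * Q +
          ψ * (κ * w * h / ρ) * G) ^ 2 + (ψ * h / ρ) ^ 2 * t) =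
          h ^ m / (κ * w * ρ) * (((m * (κ * w) - m + κ) / 2 * Q + κ * w * h * G) ^ 2 +
            h ^ 2 * t) := by
        have : ρ ^ (m + 1) * ((ψ * (m * (κ * w) - m + κ) / (2 * ρ) * Q +
          ψ * (κ * w * h / ρ) * G) ^ 2 + (ψ * h / ρ) ^ 2 * t) = ψ ^ 2 * (ρ ^ (m + 1) *
            ((((m * (κ * w) - m + κ) / 2 * Q + κ * w * h * G) ^ 2 + h ^ 2 * t) / ρ ^ 2)) := by
          field_simp
        rw [this, hsq]
        field_simp
        ring
      rw [e1, ← sub_nonneg]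
      have e2 : h ^ (m + 1) * (G ^ 2 + t - (m / 2) ^ 2 * (Q ^ 2 / h ^ 2)) * (κ * w * h / ρ) +
          (2 * Q * (G * (κ * w * h / ρ)) * (h ^ m * ((κ - m) / (2 * (κ * w)) + m / 2)) +
          Q ^ 2 * (h ^ m / ρ * (m * ((κ - m) / 2 + m / 2 * (κ * w)) + (κ - m) / (2 * w)))) -
          h ^ m / (κ * w * ρ) * (((m * (κ * w) - m + κ) / 2 * Q + κ * w * h * G) ^ 2 + h ^ 2 * t) =
          h ^ m / (κ * w * ρ) * (h ^ 2 * t * ((κ * w) ^ 2 - 1) + Q ^ 2 * ((κ - m) * (κ + m) / 4))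
            := by
        field_simp
        ring
      rw [e2]
      have h1 : 0 ≤ (κ * w) ^ 2 - 1 := by nlinarith
      have h2 : 0 ≤ (κ - m) * (κ + m) / 4 := by
        have : (0 : ℝ) ≤ κ - m := sub_nonneg.2 hmκ
        positivity
      positivity
  · refine ContinuousOn.intervalIntegrable ?_
    have : ∀ ρ ∈ Set.uIcc ρa ρb, radialProfile D a κ ρ ^ 2 ≠ 0 := fun ρ _ =>
      (pow_pos (hhpos ρ) 2).ne'
    simp only [Function.comp_apply]
    fun_prop (disch := assumption)

theorem X1_radialProfile {D a κ ρ : ℝ} (hD : 0 < D) :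
    X1 a (radialProfile D a κ ρ / D) = (ρ ^ (-κ))⁻¹ := by
  rw [X1, radialProfile, mul_div_cancel_left₀ _ hD.ne', Real.log_exp, sub_sub_cancel]

theorem rpow_radialAmplitude {D a κ ρ : ℝ} (hD : 0 < D) (hκ : 0 < κ) (hρ : 0 < ρ) {n : ℕ}
    (hn : 3 ≤ n) :
    κ ^ (2 * ((n : ℝ) - 1) / (n - 2)) *
        (ρ ^ (n - 1) * radialAmplitude (n - 2) D a κ ρ ^ (2 * (n : ℝ) / (n - 2))) =
      radialProfile D a κ ρ ^ (n - 1) *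
        X1 a (radialProfile D a κ ρ / D) ^ (2 * ((n : ℝ) - 1) / (n - 2)) *
        (κ * ρ ^ (-κ) * radialProfile D a κ ρ / ρ) := by
  have hn3 : (3 : ℝ) ≤ n := by exact_mod_cast hn
  have hn2 : 0 < (n : ℝ) - 2 := by linarith
  have hw : 0 < ρ ^ (-κ) := Real.rpow_pos_of_pos hρ _
  have hψ := radialAmplitude_pos (a := a) hD hκ hρ (n - 2)
  have hsq := radialAmplitude_sq (a := a) hD hκ hρ (n - 2)
  have hh := radialProfile_pos (a := a) (κ := κ) (ρ := ρ) hD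
  rw [X1_radialProfile hD]
  generalize radialProfile D a κ ρ = h at *
  generalize ρ ^ (-κ) = w at *
  generalize radialAmplitude (n - 2) D a κ ρ = ψ at *
  have hc : ((n - 2 : ℕ) : ℝ) = n - 2 := by push_cast [show 2 ≤ n by omega]; ring
  have e1 : ψ ^ (2 * (n : ℝ) / (n - 2)) = h ^ n / (ρ ^ n * (κ * w) ^ ((n : ℝ) / (n - 2))) := by
    have : ψ ^ (2 * (n : ℝ) / (n - 2)) = (ψ ^ 2) ^ ((n : ℝ) / (n - 2)) := by
      rw [← Real.rpow_natCast, ← Real.rpow_mul hψ.le]; congr 1; push_cast; ring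
    rw [this, hsq, Real.div_rpow (by positivity) (by positivity),
      Real.mul_rpow (by positivity) (by positivity), ← Real.rpow_natCast, ← Real.rpow_natCast,
      ← Real.rpow_mul hh.le, ← Real.rpow_mul hρ.le, hc,
      show ((n : ℝ) - 2) * (n / (n - 2)) = n by field_simp, Real.rpow_natCast, Real.rpow_natCast]
  have e2 : 2 * ((n : ℝ) - 1) / (n - 2) = 1 + n / (n - 2) := by field_simp; ring
  have e3 : h ^ n = h ^ (n - 1) * h := by rw [← pow_succ]; congr 1; omega
  have e4 : ρ ^ n = ρ ^ (n - 1) * ρ := by rw [← pow_succ]; congr 1; omega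
  rw [e1, e2, Real.mul_rpow hκ.le hw.le, Real.inv_rpow hw.le, Real.rpow_add hκ, Real.rpow_add hw,
    Real.rpow_one, Real.rpow_one, e3, e4]
  have := Real.rpow_pos_of_pos hw ((n : ℝ) / (n - 2))
  have := Real.rpow_pos_of_pos hκ ((n : ℝ) / (n - 2))
  field_simp

theorem integral_radialProfile_weight {D a κ : ℝ} (hD : 0 < D) (hκ : 0 < κ) {n : ℕ} (hn : 3 ≤ n)
    {ρa ρb : ℝ} (ha : 0 < ρa) (hab : ρa ≤ ρb)
    {g : ℝ → ℝ} (hg : Continuous g) :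
    κ ^ (2 * ((n : ℝ) - 1) / (n - 2)) * (∫ ρ in ρa..ρb, ρ ^ (n - 1) *
      |radialAmplitude (n - 2) D a κ ρ * g (radialProfile D a κ ρ)| ^ (2 * (n : ℝ) / (n - 2))) =
    ∫ r in radialProfile D a κ ρa..radialProfile D a κ ρb, r ^ (n - 1) *
      (X1 a (r / D) ^ (2 * ((n : ℝ) - 1) / (n - 2)) * |g r| ^ (2 * (n : ℝ) / (n - 2))) := by
  have hn3 : (3 : ℝ) ≤ n := by exact_mod_cast hn
  have hpos : ∀ ρ ∈ Set.uIcc ρa ρb, 0 < ρ := fun ρ hρ => by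
    rw [Set.uIcc_of_le hab] at hρ; exact ha.trans_le hρ.1
  have hp : 0 ≤ 2 * (n : ℝ) / (n - 2) := div_nonneg (by linarith) (by linarith)
  have hq : 0 ≤ 2 * ((n : ℝ) - 1) / (n - 2) := div_nonneg (by linarith) (by linarith)
  have hhpos : ∀ ρ, 0 < radialProfile D a κ ρ := fun ρ => radialProfile_pos hD
  have cw : ContinuousOn (fun ρ : ℝ => ρ ^ (-κ)) (Set.uIcc ρa ρb) := fun ρ hρ =>
    (hasDerivAt_rpow_neg (hpos ρ hρ)).continuousAt.continuousWithinAt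
  have ch : ContinuousOn (radialProfile D a κ) (Set.uIcc ρa ρb) := fun ρ hρ =>
    (hasDerivAt_radialProfile (hpos ρ hρ)).continuousAt.continuousWithinAt
  have ch' : ContinuousOn (fun ρ => κ * ρ ^ (-κ) * radialProfile D a κ ρ / ρ)
      (Set.uIcc ρa ρb) :=
    ((continuousOn_const.mul cw).mul ch).div continuousOn_id fun ρ hρ => (hpos ρ hρ).ne'
  have hcv := intervalIntegral.integral_comp_mul_deriv' (a := ρa) (b := ρb)
    (f := radialProfile D a κ)
    (f' := fun ρ => κ * ρ ^ (-κ) * radialProfile D a κ ρ / ρ)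
    (g := fun r => r ^ (n - 1) *
      (X1 a (r / D) ^ (2 * ((n : ℝ) - 1) / (n - 2)) * |g r| ^ (2 * (n : ℝ) / (n - 2))))
    (fun ρ hρ => hasDerivAt_radialProfile (hpos ρ hρ)) ch' (by
      rintro r ⟨ρ, hρ, rfl⟩
      have h1 := (hhpos ρ).ne'
      have h2 : a - Real.log (radialProfile D a κ ρ / D) ≠ 0 := by
        rw [radialProfile, mul_div_cancel_left₀ _ hD.ne', Real.log_exp, sub_sub_cancel]
        exact (Real.rpow_pos_of_pos (hpos ρ hρ) _).ne'
      have h3 : ContinuousAt (fun r => X1 a (r / D)) (radialProfile D a κ ρ) := by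
        unfold X1
        have : radialProfile D a κ ρ / D ≠ 0 := (div_pos (hhpos ρ) hD).ne'
        fun_prop (disch := assumption)
      refine ContinuousAt.continuousWithinAt ?_
      exact ((continuous_pow _).continuousAt).mul ((h3.rpow_const (Or.inr hq)).mul
        (hg.abs.continuousAt.rpow_const (Or.inr hp))))
  rw [← hcv, ← intervalIntegral.integral_const_mul]
  refine intervalIntegral.integral_congr fun ρ hρ => ?_
  have hρ0 := hpos ρ hρ
  have key := rpow_radialAmplitude (a := a) hD hκ hρ0 hn
  have hψ := radialAmplitude_pos (a := a) hD hκ hρ0 (n - 2)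
  simp only [Function.comp_apply]
  rw [abs_mul, abs_of_pos hψ, Real.mul_rpow hψ.le (abs_nonneg _)]
  linear_combination |g (radialProfile D a κ ρ)| ^ (2 * (n : ℝ) / (n - 2)) * key

section Annulus

variable {E : Type*} [NormedAddCommGroup E]

theorem eventuallyEq_zero_of_norm_lt {f : E → ℝ} {r₁ : ℝ} (hz : ∀ x, ‖x‖ < r₁ → f x = 0) {x : E}
    (hx : ‖x‖ < r₁) : f =ᶠ[nhds x] fun _ => 0 := by
  filter_upwards [continuous_norm.continuousAt.eventually_lt_const hx] with y hy using hz y hy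

theorem eventuallyEq_zero_of_lt_norm {f : E → ℝ} {r₂ : ℝ} (hz : ∀ x, r₂ < ‖x‖ → f x = 0) {x : E}
    (hx : r₂ < ‖x‖) : f =ᶠ[nhds x] fun _ => 0 := by
  filter_upwards [continuous_norm.continuousAt.eventually_const_lt hx] with y hy using hz y hy

theorem continuous_of_annulus {f : E → ℝ} {r₁ r₂ : ℝ} (hz1 : ∀ x, ‖x‖ < r₁ → f x = 0)
    (hz2 : ∀ x, r₂ < ‖x‖ → f x = 0) (hf : ∀ x, r₁ ≤ ‖x‖ → ‖x‖ ≤ r₂ → ContinuousAt f x) :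
    Continuous f := by
  refine continuous_iff_continuousAt.2 fun x => ?_
  rcases lt_or_ge ‖x‖ r₁ with h | h
  · exact continuousAt_const.congr (eventuallyEq_zero_of_norm_lt hz1 h).symm
  rcases lt_or_ge r₂ ‖x‖ with h' | h'
  · exact continuousAt_const.congr (eventuallyEq_zero_of_lt_norm hz2 h').symm
  · exact hf x h h'

theorem contDiff_of_annulus [NormedSpace ℝ E] {k : WithTop ℕ∞} {f : E → ℝ} {r₁ r₂ : ℝ}
    (hz1 : ∀ x, ‖x‖ < r₁ → f x = 0) (hz2 : ∀ x, r₂ < ‖x‖ → f x = 0)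
    (hf : ∀ x, r₁ ≤ ‖x‖ → ‖x‖ ≤ r₂ → ContDiffAt ℝ k f x) : ContDiff ℝ k f := by
  refine contDiff_iff_contDiffAt.2 fun x => ?_
  rcases lt_or_ge ‖x‖ r₁ with h | h
  · exact contDiffAt_const.congr_of_eventuallyEq (eventuallyEq_zero_of_norm_lt hz1 h)
  rcases lt_or_ge r₂ ‖x‖ with h' | h'
  · exact contDiffAt_const.congr_of_eventuallyEq (eventuallyEq_zero_of_lt_norm hz2 h')
  · exact hf x h h'

theorem hasCompactSupport_of_lt_norm [ProperSpace E] {f : E → ℝ} {r₂ : ℝ}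
    (hz : ∀ x, r₂ < ‖x‖ → f x = 0) : HasCompactSupport f :=
  HasCompactSupport.intro (isCompact_closedBall (0 : E) r₂) fun x hx =>
    hz x (by simpa using hx)

variable {F : Type*} [NormedAddCommGroup F] [InnerProductSpace ℝ F]

theorem radialProfile_rpow {D a κ r : ℝ} (hD : 0 < D) (hκ : 0 < κ) (ha : 0 < a) (hr : 0 < r)
    (hrD : r ≤ D) :
    0 < (a - Real.log (r / D)) ^ (-κ⁻¹) ∧
      ((a - Real.log (r / D)) ^ (-κ⁻¹)) ^ (-κ) = a - Real.log (r / D) ∧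
      radialProfile D a κ ((a - Real.log (r / D)) ^ (-κ⁻¹)) = r := by
  have h0 : 0 < a - Real.log (r / D) := by
    have := Real.log_nonpos (div_nonneg hr.le hD.le) ((div_le_one hD).2 hrD)
    linarith
  have h1 : ((a - Real.log (r / D)) ^ (-κ⁻¹)) ^ (-κ) = a - Real.log (r / D) := by
    rw [← Real.rpow_mul h0.le, neg_mul_neg, inv_mul_cancel₀ hκ.ne', Real.rpow_one]
  refine ⟨Real.rpow_pos_of_pos h0 _, h1, ?_⟩
  rw [radialProfile, h1, sub_sub_cancel, Real.exp_log (by positivity), mul_div_cancel₀ _ hD.ne']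

theorem radialProfile_le {D a κ ρ ρ' : ℝ} (hD : 0 < D) (hκ : 0 < κ) (hρ : 0 < ρ) (h : ρ ≤ ρ') :
    radialProfile D a κ ρ ≤ radialProfile D a κ ρ' := by
  have := Real.rpow_le_rpow_of_nonpos hρ h (neg_nonpos.2 hκ.le)
  unfold radialProfile
  gcongr

theorem contDiffAt_radialProfile {D a κ ρ : ℝ} (hρ : 0 < ρ) :
    ContDiffAt ℝ 1 (radialProfile D a κ) ρ :=
  contDiffAt_const.mul (contDiffAt_const.sub
    (Real.contDiffAt_rpow_const_of_ne hρ.ne')).exp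

theorem contDiffAt_radialAmplitude {D a κ ρ : ℝ} (hD : 0 < D) (hκ : 0 < κ) (hρ : 0 < ρ) (m : ℕ) :
    ContDiffAt ℝ 1 (radialAmplitude m D a κ) ρ := by
  have hh := radialProfile_pos (a := a) (κ := κ) (ρ := ρ) hD
  have hw : 0 < ρ ^ (-κ) := Real.rpow_pos_of_pos hρ _
  exact (((contDiffAt_radialProfile hρ).pow m).div ((contDiffAt_id.pow m).mul
    (contDiffAt_const.mul (Real.contDiffAt_rpow_const_of_ne hρ.ne')))
      (by simp only [id]; positivity)).sqrt (by
        have : 0 < radialProfile D a κ ρ ^ m / (ρ ^ m * (κ * ρ ^ (-κ))) := by positivity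
        exact this.ne')

/-- The function `u` transported by the radial change of variables. -/
noncomputable def radialTransport (m : ℕ) (D a κ : ℝ) (u : F → ℝ) (y : F) : ℝ :=
  radialAmplitude m D a κ ‖y‖ * u ((radialProfile D a κ ‖y‖ / ‖y‖) • y)

theorem radialTransport_smul {m : ℕ} {D a κ ρ : ℝ} {u : F → ℝ} {θ : F} (hθ : ‖θ‖ = 1)
    (hρ : 0 < ρ) : radialTransport m D a κ u (ρ • θ) =
      radialAmplitude m D a κ ρ * u (radialProfile D a κ ρ • θ) := by
  have hn : ‖ρ • θ‖ = ρ := by rw [norm_smul, hθ, mul_one, Real.norm_of_nonneg hρ.le]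
  rw [radialTransport, hn, smul_smul, div_mul_cancel₀ _ hρ.ne']

theorem norm_radialProfile_smul {D a κ : ℝ} (hD : 0 < D) {y : F} (hy : y ≠ 0) :
    ‖(radialProfile D a κ ‖y‖ / ‖y‖) • y‖ = radialProfile D a κ ‖y‖ := by
  have hh := radialProfile_pos (a := a) (κ := κ) (ρ := ‖y‖) hD
  have := norm_pos_iff.2 hy
  rw [norm_smul, Real.norm_of_nonneg (by positivity), div_mul_cancel₀ _ this.ne']

theorem contDiffAt_radialTransport {m : ℕ} {D a κ : ℝ} (hD : 0 < D) (hκ : 0 < κ) {u : F → ℝ}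
    (hu : ContDiff ℝ 1 u) {y : F} (hy : y ≠ 0) :
    ContDiffAt ℝ 1 (radialTransport m D a κ u) y := by
  have hp := norm_pos_iff.2 hy
  have hN : ContDiffAt ℝ 1 (fun y : F => ‖y‖) y := contDiffAt_norm ℝ hy
  exact ((contDiffAt_radialAmplitude hD hκ hp m).comp y hN).mul
    (hu.contDiffAt.comp y ((((contDiffAt_radialProfile hp).comp y hN).div hN hp.ne').smul
      contDiffAt_id))

variable [CompleteSpace F]

theorem gradient_eq_zero_of_eventuallyEq {f : F → ℝ} {x : F} (h : f =ᶠ[nhds x] fun _ => 0) :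
    gradient f x = 0 := by
  rw [h.gradient_eq]
  simp [gradient]

theorem continuous_gradient {f : F → ℝ} (hf : ContDiff ℝ 1 f) : Continuous (gradient f) :=
  (InnerProductSpace.toDual ℝ F).symm.continuous.comp (hf.continuous_fderiv (by norm_num))

theorem hasDerivAt_comp_smul {f : F → ℝ} (hf : Differentiable ℝ f) (θ : F) (r : ℝ) :
    HasDerivAt (fun r : ℝ => f (r • θ)) (inner ℝ (gradient f (r • θ)) θ) r := by
  rw [inner_gradient_left]
  have h : HasDerivAt (fun r : ℝ => r • θ) θ r := by
    simpa using (hasDerivAt_id r).smul_const θ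
  exact (hf (r • θ)).hasFDerivAt.comp_hasDerivAt r h

end Annulus

theorem ray_energy_le {F : Type*} [NormedAddCommGroup F] [InnerProductSpace ℝ F] [CompleteSpace F]
    {n : ℕ} (hn : 3 ≤ n) {D a κ ρa ρb : ℝ} (hD : 0 < D) (hκ : 0 < κ) (hnκ : (n : ℝ) - 2 ≤ κ)
    (ha : 0 < ρa) (hab : ρa ≤ ρb) (hb : 1 ≤ κ * ρb ^ (-κ)) {u : F → ℝ} (hu : ContDiff ℝ 1 u)
    {θ : F} (hθ : ‖θ‖ = 1) (hua : u (radialProfile D a κ ρa • θ) = 0)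
    (hub : u (radialProfile D a κ ρb • θ) = 0) :
    ∫ ρ in ρa..ρb, ρ ^ (n - 1) * ‖gradient (radialTransport (n - 2) D a κ u) (ρ • θ)‖ ^ 2 ≤
      ∫ r in radialProfile D a κ ρa..radialProfile D a κ ρb, r ^ (n - 1) *
        (‖gradient u (r • θ)‖ ^ 2 - (((n : ℝ) - 2) / 2) ^ 2 * (u (r • θ) ^ 2 / ‖r • θ‖ ^ 2)) := by
  have hc : ((n - 2 : ℕ) : ℝ) = n - 2 := by push_cast [show 2 ≤ n by omega]; ring
  have hG := continuous_gradient hu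
  have hs : Continuous fun r : ℝ => r • θ := by fun_prop
  have hbb : ∀ ρ ∈ Set.Icc ρa ρb, 1 ≤ κ * ρ ^ (-κ) := fun ρ hρ => hb.trans <|
    mul_le_mul_of_nonneg_left (Real.rpow_le_rpow_of_nonpos (ha.trans_le hρ.1) hρ.2
      (neg_nonpos.2 hκ.le)) hκ.le
  have key := radial_hardy_energy_le (a := a) hD hκ (m := n - 2) (by omega) (by rw [hc]; exact hnκ)
    ha hab hbb (g := fun r => u (r • θ)) (g' := fun r => inner ℝ (gradient u (r • θ)) θ)
    (T := fun r => ‖gradient u (r • θ)‖ ^ 2 - inner ℝ (gradient u (r • θ)) θ ^ 2)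
    (hasDerivAt_comp_smul (hu.differentiable (by norm_num)) θ)
    ((hG.comp hs).inner continuous_const)
    (((hG.comp hs).norm.pow 2).sub (((hG.comp hs).inner continuous_const).pow 2))
    (fun r => by
      have := abs_real_inner_le_norm (gradient u (r • θ)) θ
      rw [hθ, mul_one] at this
      rw [sub_nonneg, ← sq_abs]
      gcongr) hua hub
  have hm : n - 2 + 1 = n - 1 := by omega
  rw [hm, hc] at key
  convert key using 1
  · refine intervalIntegral.integral_congr fun ρ hρ => ?_
    rw [Set.uIcc_of_le hab] at hρ
    have hρ0 : 0 < ρ := ha.trans_le hρ.1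
    have e := norm_sq_gradient_radial_comp hθ hρ0
      ((hu.differentiable (by norm_num)) (radialProfile D a κ ρ • θ))
      (hasDerivAt_radialAmplitude (a := a) hD hκ hρ0 (m := n - 2) (by omega))
      (hasDerivAt_radialProfile (D := D) (a := a) (κ := κ) hρ0)
    unfold radialTransport
    rw [e, hc]
  · refine intervalIntegral.integral_congr fun r hr => ?_
    rw [Set.uIcc_of_le (radialProfile_le hD hκ ha hab)] at hr
    have hr0 : 0 < r := (radialProfile_pos hD).trans_le hr.1
    have hn : ‖r • θ‖ = r := by rw [norm_smul, hθ, mul_one, Real.norm_of_nonneg hr0.le]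
    simp only [hn]
    ring

theorem hardy_sobolev_annulus {n : ℕ} (hn : 3 ≤ n) {D a κ r₁ r₂ : ℝ} (hD : 0 < D) (ha : 0 < a)
    (hnκ : (n : ℝ) - 2 ≤ κ) (hκa : 1 ≤ κ * a) (h1 : 0 < r₁) (h12 : r₁ ≤ r₂) (h2 : r₂ ≤ D)
    {u : EuclideanSpace ℝ (Fin n) → ℝ} (hu : ContDiff ℝ 1 u)
    (hz1 : ∀ x, ‖x‖ ≤ r₁ → u x = 0) (hz2 : ∀ x, r₂ ≤ ‖x‖ → u x = 0) :
    κ ^ (-(2 * ((n : ℝ) - 1)) / n) * sobolevConst n *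
      (∫ x, X1 a (‖x‖ / D) ^ (2 * ((n : ℝ) - 1) / (n - 2)) *
        |u x| ^ (2 * (n : ℝ) / (n - 2))) ^ (((n : ℝ) - 2) / n) ≤
      (∫ x, ‖gradient u x‖ ^ 2) - (((n : ℝ) - 2) / 2) ^ 2 * ∫ x, u x ^ 2 / ‖x‖ ^ 2 := by
  have hn3 : (3 : ℝ) ≤ n := by exact_mod_cast hn
  have hn2 : 0 < (n : ℝ) - 2 := by linarith
  have hκ : 0 < κ := hn2.trans_le hnκ
  have : Nontrivial (EuclideanSpace ℝ (Fin n)) := by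
    have : Nontrivial (Fin n) := Fin.nontrivial_iff_two_le.2 (by omega)
    infer_instance
  have hfin : Module.finrank ℝ (EuclideanSpace ℝ (Fin n)) = n := by simp
  obtain ⟨ha0, ha1, ha2⟩ := radialProfile_rpow hD hκ ha h1 (h12.trans h2)
  obtain ⟨hb0, hb1, hb2⟩ := radialProfile_rpow hD hκ ha (h1.trans_le h12) h2
  set ρa := (a - Real.log (r₁ / D)) ^ (-κ⁻¹) with hρa
  set ρb := (a - Real.log (r₂ / D)) ^ (-κ⁻¹) with hρb
  have hlog : Real.log (r₁ / D) ≤ Real.log (r₂ / D) :=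
    Real.log_le_log (by positivity) (by gcongr)
  have hlog2 : Real.log (r₂ / D) ≤ 0 :=
    Real.log_nonpos (by have := h1.trans_le h12; positivity) ((div_le_one hD).2 h2)
  have hab : ρa ≤ ρb :=
    Real.rpow_le_rpow_of_nonpos (by linarith) (by linarith) (by simpa using hκ.le)
  have hb : 1 ≤ κ * ρb ^ (-κ) := by rw [hb1]; nlinarith
  set U := radialTransport (n - 2) D a κ u with hU
  have hUa : ∀ y, ‖y‖ ≤ ρa → U y = 0 := by
    intro y hy
    by_cases hy0 : y = 0
    · rw [hU, radialTransport, hy0, smul_zero, hz1 0 (by simpa using h1.le), mul_zero]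
    · rw [hU, radialTransport, hz1, mul_zero]
      rw [norm_radialProfile_smul hD hy0, ← ha2]
      exact radialProfile_le hD hκ (norm_pos_iff.2 hy0) hy
  have hUb : ∀ y, ρb ≤ ‖y‖ → U y = 0 := by
    intro y hy
    have hy0 : y ≠ 0 := norm_pos_iff.1 (hb0.trans_le hy)
    rw [hU, radialTransport, hz2, mul_zero]
    rw [norm_radialProfile_smul hD hy0, ← hb2]
    exact radialProfile_le hD hκ hb0 hy
  have hUc : ContDiff ℝ 1 U := contDiff_of_annulus (fun y hy => hUa y hy.le)
    (fun y hy => hUb y hy.le) fun y hy _ =>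
      contDiffAt_radialTransport hD hκ hu (norm_pos_iff.1 (ha0.trans_le hy))
  have hUs : HasCompactSupport U := hasCompactSupport_of_lt_norm fun y hy => hUb y hy.le
  have hSob := sobolev_euclidean hn hUc hUs
  -- the Dirichlet integrals
  have hgU1 : ∀ y, ‖y‖ < ρa → gradient U y = 0 := fun y hy =>
    gradient_eq_zero_of_eventuallyEq (eventuallyEq_zero_of_norm_lt (fun z hz => hUa z hz.le) hy)
  have hgU2 : ∀ y, ρb < ‖y‖ → gradient U y = 0 := fun y hy =>
    gradient_eq_zero_of_eventuallyEq (eventuallyEq_zero_of_lt_norm (fun z hz => hUb z hz.le) hy)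
  have hg1 : ∀ y, ‖y‖ < r₁ → gradient u y = 0 := fun y hy =>
    gradient_eq_zero_of_eventuallyEq (eventuallyEq_zero_of_norm_lt (fun z hz => hz1 z hz.le) hy)
  have hg2 : ∀ y, r₂ < ‖y‖ → gradient u y = 0 := fun y hy =>
    gradient_eq_zero_of_eventuallyEq (eventuallyEq_zero_of_lt_norm (fun z hz => hz2 z hz.le) hy)
  have hgi : Integrable fun x => ‖gradient u x‖ ^ 2 :=
    ((continuous_gradient hu).norm.pow 2).integrable_of_hasCompactSupport
      (hasCompactSupport_of_lt_norm (r₂ := r₂) fun x hx => by simp [hg2 x hx])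
  have hhi : Integrable fun x => u x ^ 2 / ‖x‖ ^ 2 := by
    refine Continuous.integrable_of_hasCompactSupport ?_
      (hasCompactSupport_of_lt_norm (r₂ := r₂) fun x hx => by simp [hz2 x hx.le])
    refine continuous_of_annulus (r₁ := r₁) (r₂ := r₂) (fun x hx => by simp [hz1 x hx.le])
      (fun x hx => by simp [hz2 x hx.le]) fun x hx _ => ?_
    have : 0 < ‖x‖ := h1.trans_le hx
    exact (hu.continuous.pow 2).continuousAt.div (continuous_norm.pow 2).continuousAt (by positivity)
  have hGi : Integrable fun x => ‖gradient U x‖ ^ 2 :=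
    ((continuous_gradient hUc).norm.pow 2).integrable_of_hasCompactSupport
      (hasCompactSupport_of_lt_norm (r₂ := ρb) fun x hx => by simp [hgU2 x hx])
  have hdir : ∫ x, ‖gradient U x‖ ^ 2 ≤
      (∫ x, ‖gradient u x‖ ^ 2) - (((n : ℝ) - 2) / 2) ^ 2 * ∫ x, u x ^ 2 / ‖x‖ ^ 2 := by
    rw [← integral_const_mul, ← integral_sub hgi (hhi.const_mul _)]
    obtain ⟨i1, e1⟩ := integral_annulus_eq hfin hGi ha0 hab
      (fun x hx => by simp [hgU1 x hx]) (fun x hx => by simp [hgU2 x hx])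
    obtain ⟨i2, e2⟩ := integral_annulus_eq hfin (hgi.sub (hhi.const_mul ((((n : ℝ) - 2) / 2) ^ 2)))
      h1 h12 (fun x hx => by simp [hg1 x hx, hz1 x hx.le])
      (fun x hx => by simp [hg2 x hx, hz2 x hx.le])
    simp only [Pi.sub_apply] at e2 i2
    rw [e1, e2]
    refine integral_mono i1 i2 fun θ => ?_
    have hθ : ‖(θ : EuclideanSpace ℝ (Fin n))‖ = 1 := norm_eq_of_mem_sphere θ
    have := ray_energy_le hn hD hκ hnκ ha0 hab hb (a := a) hu hθ
      (hz1 _ (by rw [ha2, norm_smul, hθ, mul_one, Real.norm_of_nonneg h1.le]))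
      (hz2 _ (by rw [hb2, norm_smul, hθ, mul_one, Real.norm_of_nonneg (h1.trans_le h12).le]))
    rwa [ha2, hb2] at this
  -- the weighted Lebesgue norms
  have hp : 0 < 2 * (n : ℝ) / (n - 2) := by positivity
  have hPi : Integrable fun x => |U x| ^ (2 * (n : ℝ) / (n - 2)) := by
    refine Continuous.integrable_of_hasCompactSupport
      (hUc.continuous.abs.rpow_const fun _ => Or.inr hp.le)
      (hasCompactSupport_of_lt_norm (r₂ := ρb) fun x hx => ?_)
    rw [hUb x hx.le, abs_zero, Real.zero_rpow hp.ne']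
  have hW1 : ∀ x, u x = 0 → X1 a (‖x‖ / D) ^ (2 * ((n : ℝ) - 1) / (n - 2)) *
      |u x| ^ (2 * (n : ℝ) / (n - 2)) = 0 := fun x hx => by
    rw [hx, abs_zero, Real.zero_rpow hp.ne', mul_zero]
  have hQi : Integrable fun x => X1 a (‖x‖ / D) ^ (2 * ((n : ℝ) - 1) / (n - 2)) *
      |u x| ^ (2 * (n : ℝ) / (n - 2)) := by
    refine Continuous.integrable_of_hasCompactSupport ?_
      (hasCompactSupport_of_lt_norm (r₂ := r₂) fun x hx => hW1 x (hz2 x hx.le))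
    refine continuous_of_annulus (r₁ := r₁) (r₂ := r₂) (fun x hx => hW1 x (hz1 x hx.le))
      (fun x hx => hW1 x (hz2 x hx.le)) fun x hx hx' => ?_
    have hx0 : 0 < ‖x‖ := h1.trans_le hx
    have hl : 0 < a - Real.log (‖x‖ / D) := by
      have := Real.log_nonpos (div_nonneg hx0.le hD.le) ((div_le_one hD).2 (hx'.trans h2))
      linarith
    refine ContinuousAt.mul ?_ (hu.continuous.abs.rpow_const fun _ => Or.inr hp.le).continuousAt
    refine ContinuousAt.rpow_const ?_ (Or.inl (inv_pos.2 hl).ne')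
    exact (continuousAt_const.sub ((continuous_norm.div_const D).continuousAt.log
      (by positivity))).inv₀ hl.ne'
  have hweight : κ ^ (2 * ((n : ℝ) - 1) / (n - 2)) * ∫ x, |U x| ^ (2 * (n : ℝ) / (n - 2)) =
      ∫ x, X1 a (‖x‖ / D) ^ (2 * ((n : ℝ) - 1) / (n - 2)) *
        |u x| ^ (2 * (n : ℝ) / (n - 2)) := by
    obtain ⟨-, e1⟩ := integral_annulus_eq hfin hPi ha0 hab
      (fun x hx => by rw [hUa x hx.le, abs_zero, Real.zero_rpow hp.ne'])
      (fun x hx => by rw [hUb x hx.le, abs_zero, Real.zero_rpow hp.ne'])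
    obtain ⟨-, e2⟩ := integral_annulus_eq hfin hQi h1 h12
      (fun x hx => hW1 x (hz1 x hx.le)) (fun x hx => hW1 x (hz2 x hx.le))
    rw [e1, e2, ← integral_const_mul]
    refine integral_congr_ae (Filter.Eventually.of_forall fun θ => ?_)
    have hθ : ‖(θ : EuclideanSpace ℝ (Fin n))‖ = 1 := norm_eq_of_mem_sphere θ
    have key := integral_radialProfile_weight (a := a) hD hκ hn ha0 hab
      (g := fun r => u (r • (θ : EuclideanSpace ℝ (Fin n))))
      (hu.continuous.comp (by fun_prop))
    rw [ha2, hb2] at key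
    simp only
    convert key using 1
    · congr 1
      refine intervalIntegral.integral_congr fun ρ hρ => ?_
      rw [Set.uIcc_of_le hab] at hρ
      simp only [hU, radialTransport_smul hθ (ha0.trans_le hρ.1)]
    · refine intervalIntegral.integral_congr fun r hr => ?_
      rw [Set.uIcc_of_le h12] at hr
      rw [norm_smul, hθ, mul_one, Real.norm_of_nonneg (h1.trans_le hr.1).le]
  refine le_trans (le_of_eq ?_) (hSob.trans hdir)
  rw [← hweight, Real.mul_rpow (Real.rpow_nonneg hκ.le _)
    (integral_nonneg fun x => Real.rpow_nonneg (abs_nonneg _) _), ← Real.rpow_mul hκ.le]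
  have e3 : 2 * ((n : ℝ) - 1) / (n - 2) * ((n - 2) / n) = -(-(2 * ((n : ℝ) - 1)) / n) := by
    field_simp
  rw [e3, Real.rpow_neg hκ.le]
  have : 0 < κ ^ (-(2 * ((n : ℝ) - 1)) / (n : ℝ)) := Real.rpow_pos_of_pos hκ _
  field_simp

section Cutoff

variable {F : Type*} [NormedAddCommGroup F]

/-- A smooth cutoff that vanishes for `‖x‖ ≤ k⁻¹` and equals `1` for `‖x‖ ≥ √2 k⁻¹`. -/
noncomputable def originCutoff (k : ℝ) (x : F) : ℝ := Real.smoothTransition (k ^ 2 * ‖x‖ ^ 2 - 1)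

theorem originCutoff_eq_zero {k : ℝ} (hk : 0 < k) {x : F} (hx : ‖x‖ ≤ k⁻¹) :
    originCutoff k x = 0 := by
  refine Real.smoothTransition.zero_of_nonpos ?_
  have h : k * ‖x‖ ≤ 1 := by
    have := mul_le_mul_of_nonneg_left hx hk.le
    rwa [mul_inv_cancel₀ hk.ne'] at this
  have : 0 ≤ k * ‖x‖ := by positivity
  nlinarith

theorem abs_originCutoff_le (k : ℝ) (x : F) : |originCutoff k x| ≤ 1 := by
  rw [originCutoff, abs_of_nonneg (Real.smoothTransition.nonneg _)]
  exact Real.smoothTransition.le_one _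

theorem eventually_originCutoff_eq_one {x : F} (hx : x ≠ 0) :
    ∀ᶠ k : ℕ in Filter.atTop, originCutoff (k : ℝ) =ᶠ[nhds x] fun _ => (1 : ℝ) := by
  have hp := norm_pos_iff.2 hx
  obtain ⟨N, hN⟩ := exists_nat_gt (2 / ‖x‖)
  filter_upwards [Filter.eventually_ge_atTop N] with k hk
  have hk' : 2 / ‖x‖ < k := hN.trans_le (by exact_mod_cast hk)
  have h2 : 2 < k * ‖x‖ := by rwa [div_lt_iff₀ hp] at hk'
  have hc : Continuous fun y : F => (k : ℝ) * ‖y‖ := by fun_prop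
  filter_upwards [hc.continuousAt.eventually_const_lt h2] with y hy
  refine Real.smoothTransition.one_of_one_le ?_
  nlinarith

variable [InnerProductSpace ℝ F]

theorem contDiff_originCutoff (k : ℝ) : ContDiff ℝ 1 (originCutoff k : F → ℝ) :=
  (Real.smoothTransition.contDiff (n := 1)).comp
    ((contDiff_const.mul (contDiff_norm_sq ℝ)).sub contDiff_const)

theorem exists_norm_fderiv_originCutoff_le :
    ∃ M : ℝ, 0 ≤ M ∧ ∀ (k : ℝ) (x : F), ‖fderiv ℝ (originCutoff k) x‖ * ‖x‖ ≤ M := by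
  have hst : ContDiff ℝ 1 Real.smoothTransition := Real.smoothTransition.contDiff (n := 1)
  have hd0 : ∀ s, s ∉ Set.Icc (0 : ℝ) 1 → deriv Real.smoothTransition s = 0 := by
    intro s hs
    rw [Set.mem_Icc, not_and_or, not_le, not_le] at hs
    rcases hs with hs | hs
    · have : Real.smoothTransition =ᶠ[nhds s] fun _ => 0 := by
        filter_upwards [eventually_lt_nhds hs] with t ht
        exact Real.smoothTransition.zero_of_nonpos ht.le
      rw [this.deriv_eq, deriv_const]
    · have : Real.smoothTransition =ᶠ[nhds s] fun _ => 1 := by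
        filter_upwards [eventually_gt_nhds hs] with t ht
        exact Real.smoothTransition.one_of_one_le ht.le
      rw [this.deriv_eq, deriv_const]
  have hcs : HasCompactSupport fun s => (s + 1) * deriv Real.smoothTransition s :=
    HasCompactSupport.intro (isCompact_Icc (a := (0 : ℝ)) (b := 1)) fun s hs => by
      rw [hd0 s hs, mul_zero]
  obtain ⟨C, hC⟩ := hcs.exists_bound_of_continuous
    ((continuous_id.add continuous_const).mul (hst.continuous_deriv (by norm_num)))
  have hC0 : 0 ≤ C := (norm_nonneg _).trans (hC 0)
  refine ⟨2 * C, by positivity, fun k x => ?_⟩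
  have h1 := ((hasFDerivAt_id (𝕜 := ℝ) x).norm_sq.const_mul (k ^ 2)).sub_const 1
  have h2 := (hst.differentiable (by norm_num) (k ^ 2 * ‖x‖ ^ 2 - 1)).hasDerivAt.comp_hasFDerivAt
    x h1
  change HasFDerivAt (originCutoff k) _ x at h2
  rw [h2.fderiv]
  simp only [id, ContinuousLinearMap.comp_id, norm_smul]
  have h3 := hC (k ^ 2 * ‖x‖ ^ 2 - 1)
  rw [sub_add_cancel, norm_mul, Real.norm_of_nonneg (by positivity)] at h3
  rw [Real.norm_of_nonneg (sq_nonneg k)]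
  have h4 : ‖(2 : ℕ) • innerSL ℝ x‖ ≤ 2 * ‖x‖ := by
    refine (norm_nsmul_le).trans ?_
    simp
  calc _ ≤ ‖deriv Real.smoothTransition (k ^ 2 * ‖x‖ ^ 2 - 1)‖ * (k ^ 2 * (2 * ‖x‖)) * ‖x‖ := by
        gcongr
    _ = 2 * (k ^ 2 * ‖x‖ ^ 2 * ‖deriv Real.smoothTransition (k ^ 2 * ‖x‖ ^ 2 - 1)‖) := by ring
    _ ≤ _ := by gcongr

theorem norm_gradient_eq [CompleteSpace F] (f : F → ℝ) (x : F) :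
    ‖gradient f x‖ = ‖fderiv ℝ f x‖ :=
  (InnerProductSpace.toDual ℝ F).symm.norm_map _

theorem norm_sq_gradient_mul_originCutoff_le [CompleteSpace F] {M : ℝ}
    (hM : ∀ (k : ℝ) (x : F), ‖fderiv ℝ (originCutoff k) x‖ * ‖x‖ ≤ M) {u : F → ℝ} {x : F}
    (hu : DifferentiableAt ℝ u x) (hx : x ≠ 0) (k : ℝ) :
    ‖gradient (fun y => u y * originCutoff k y) x‖ ^ 2 ≤
      2 * ‖gradient u x‖ ^ 2 + 2 * M ^ 2 * (u x ^ 2 / ‖x‖ ^ 2) := by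
  have hp := norm_pos_iff.2 hx
  have h := (hu.hasFDerivAt.mul
    ((contDiff_originCutoff (F := F) k).differentiable (by norm_num) x).hasFDerivAt).fderiv
  rw [norm_gradient_eq, norm_gradient_eq]
  have h1 : ‖fderiv ℝ (fun y => u y * originCutoff k y) x‖ ≤
      |u x| * (M / ‖x‖) + 1 * ‖fderiv ℝ u x‖ := by
    change fderiv ℝ (fun y => u y * originCutoff k y) x = _ at h
    rw [h]
    refine (norm_add_le _ _).trans ?_
    rw [norm_smul, norm_smul, Real.norm_eq_abs, Real.norm_eq_abs]
    gcongr
    · rw [le_div_iff₀ hp]; exact hM k x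
    · exact abs_originCutoff_le k x
  calc _ ≤ (|u x| * (M / ‖x‖) + 1 * ‖fderiv ℝ u x‖) ^ 2 := by gcongr
    _ ≤ 2 * ‖fderiv ℝ u x‖ ^ 2 + 2 * (|u x| * (M / ‖x‖)) ^ 2 := by
      nlinarith [sq_nonneg (|u x| * (M / ‖x‖) - ‖fderiv ℝ u x‖)]
    _ = _ := by rw [mul_pow, sq_abs]; ring

end Cutoff

theorem integrable_sq_div_norm_sq {E : Type*} [NormedAddCommGroup E] [NormedSpace ℝ E]
    [FiniteDimensional ℝ E] [MeasurableSpace E] [BorelSpace E] {μ : Measure E}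
    [μ.IsAddHaarMeasure] (hE : 3 ≤ Module.finrank ℝ E) {u : E → ℝ} (hu : Continuous u)
    (hc : HasCompactSupport u) : Integrable (fun x => u x ^ 2 / ‖x‖ ^ 2) μ := by
  have : Nontrivial E := Module.nontrivial_of_finrank_pos (R := ℝ) (by omega)
  obtain ⟨C, hC⟩ := hc.exists_bound_of_continuous hu
  have hb : Bornology.IsBounded (tsupport u) := hc.isBounded
  obtain ⟨R, hR⟩ := hb.subset_closedBall (0 : E)
  have h1 : Integrable (fun x : E => (Set.Iic R).indicator (fun r : ℝ => C ^ 2 / r ^ 2) ‖x‖) μ := by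
    rw [integrable_fun_norm_addHaar]
    have e : IntegrableOn (fun y : ℝ => C ^ 2 * y ^ (Module.finrank ℝ E - 3)) (Set.Ioc 0 R) :=
      (Continuous.integrableOn_Icc (by fun_prop)).mono_set Set.Ioc_subset_Icc_self
    have e2 : IntegrableOn (fun y : ℝ => (Set.Iic R).indicator
        (fun y => C ^ 2 * y ^ (Module.finrank ℝ E - 3)) y) (Set.Ioi 0) := by
      rw [IntegrableOn, integrable_indicator_iff measurableSet_Iic, IntegrableOn,
        Measure.restrict_restrict measurableSet_Iic, Set.inter_comm, Set.Ioi_inter_Iic]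
      exact e
    refine e2.congr_fun (fun y hy => ?_) measurableSet_Ioi
    have hy0 : (0 : ℝ) < y := hy
    by_cases hyR : y ∈ Set.Iic R
    · simp only [Set.indicator_of_mem hyR, smul_eq_mul]
      obtain ⟨d, hd⟩ := Nat.exists_eq_add_of_le hE
      rw [hd, show 3 + d - 3 = d by omega, show 3 + d - 1 = d + 2 by omega, pow_add]
      field_simp
    · simp [Set.indicator_of_notMem hyR]
  refine h1.mono' ((hu.measurable.pow_const 2).div
    (continuous_norm.measurable.pow_const 2)).aestronglyMeasurable
    (Filter.Eventually.of_forall fun x => ?_)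
  rw [Real.norm_of_nonneg (by positivity)]
  by_cases hx : ‖x‖ ∈ Set.Iic R
  · rw [Set.indicator_of_mem hx, ← sq_abs, ← Real.norm_eq_abs]
    gcongr
    exact hC x
  · have : u x = 0 := by
      refine image_eq_zero_of_notMem_tsupport fun h => hx ?_
      simpa using hR h
    rw [Set.indicator_of_notMem hx, this]
    simp

theorem hardy_sobolev_ball {n : ℕ} (hn : 3 ≤ n) {D a κ : ℝ} (hD : 0 < D) (ha : 0 < a)
    (hnκ : (n : ℝ) - 2 ≤ κ) (hκa : 1 ≤ κ * a)
    {u : EuclideanSpace ℝ (Fin n) → ℝ} (hu : ContDiff ℝ 1 u) (hz : ∀ x, D ≤ ‖x‖ → u x = 0) :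
    κ ^ (-(2 * ((n : ℝ) - 1)) / n) * sobolevConst n *
      (∫ x, X1 a (‖x‖ / D) ^ (2 * ((n : ℝ) - 1) / (n - 2)) *
        |u x| ^ (2 * (n : ℝ) / (n - 2))) ^ (((n : ℝ) - 2) / n) ≤
      (∫ x, ‖gradient u x‖ ^ 2) - (((n : ℝ) - 2) / 2) ^ 2 * ∫ x, u x ^ 2 / ‖x‖ ^ 2 := by
  have hn3 : (3 : ℝ) ≤ n := by exact_mod_cast hn
  have hn2 : 0 < (n : ℝ) - 2 := by linarith
  have hp : 0 < 2 * (n : ℝ) / (n - 2) := by positivity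
  have hq : 0 ≤ 2 * ((n : ℝ) - 1) / (n - 2) := div_nonneg (by linarith) hn2.le
  have : Nontrivial (EuclideanSpace ℝ (Fin n)) := by
    have : Nontrivial (Fin n) := Fin.nontrivial_iff_two_le.2 (by omega)
    infer_instance
  have hcs : HasCompactSupport u := hasCompactSupport_of_lt_norm fun x hx => hz x hx.le
  have hhi : Integrable fun x => u x ^ 2 / ‖x‖ ^ 2 :=
    integrable_sq_div_norm_sq (by simpa using hn) hu.continuous hcs
  have hgi : Integrable fun x => ‖gradient u x‖ ^ 2 :=
    ((continuous_gradient hu).norm.pow 2).integrable_of_hasCompactSupport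
      (hasCompactSupport_of_lt_norm (r₂ := D) fun x hx => by
        have := gradient_eq_zero_of_eventuallyEq
          (eventuallyEq_zero_of_lt_norm (fun z hz' => hz z hz'.le) hx)
        simp [this])
  obtain ⟨M, -, hM⟩ := exists_norm_fderiv_originCutoff_le (F := EuclideanSpace ℝ (Fin n))
  have hX : ∀ x : EuclideanSpace ℝ (Fin n), ‖x‖ < D →
      0 ≤ X1 a (‖x‖ / D) ∧ X1 a (‖x‖ / D) ≤ a⁻¹ := by
    intro x hx
    have : Real.log (‖x‖ / D) ≤ 0 :=
      Real.log_nonpos (by positivity) ((div_le_one hD).2 hx.le)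
    exact ⟨inv_nonneg.2 (by linarith), inv_anti₀ ha (by linarith)⟩
  set W : EuclideanSpace ℝ (Fin n) → ℝ :=
    fun x => X1 a (‖x‖ / D) ^ (2 * ((n : ℝ) - 1) / (n - 2)) with hW
  have hWm : Measurable W :=
    ((measurable_const.sub (Real.measurable_log.comp
      (continuous_norm.measurable.div_const D))).inv).pow_const _
  have hQi : Integrable fun x => W x * |u x| ^ (2 * (n : ℝ) / (n - 2)) := by
    have h1 : Integrable fun x => a⁻¹ ^ (2 * ((n : ℝ) - 1) / (n - 2)) *
        |u x| ^ (2 * (n : ℝ) / (n - 2)) := by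
      refine Integrable.const_mul (Continuous.integrable_of_hasCompactSupport
        (hu.continuous.abs.rpow_const fun _ => Or.inr hp.le)
        (hasCompactSupport_of_lt_norm (r₂ := D) fun x hx => ?_)) _
      rw [hz x hx.le, abs_zero, Real.zero_rpow hp.ne']
    refine h1.mono' (hWm.mul
      (hu.continuous.abs.rpow_const fun _ => Or.inr hp.le).measurable).aestronglyMeasurable
      (Filter.Eventually.of_forall fun x => ?_)
    rcases lt_or_ge ‖x‖ D with hx | hx
    · obtain ⟨h0, h1⟩ := hX x hx
      rw [Real.norm_of_nonneg (mul_nonneg (Real.rpow_nonneg h0 _)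
        (Real.rpow_nonneg (abs_nonneg _) _))]
      exact mul_le_mul_of_nonneg_right (Real.rpow_le_rpow h0 h1 hq)
        (Real.rpow_nonneg (abs_nonneg _) _)
    · simp [hz x hx, Real.zero_rpow hp.ne']
  set v : ℕ → EuclideanSpace ℝ (Fin n) → ℝ := fun k x => u x * originCutoff (k : ℝ) x with hv
  have hvc : ∀ k, ContDiff ℝ 1 (v k) := fun k => hu.mul (contDiff_originCutoff _)
  have hvle : ∀ k x, |v k x| ≤ |u x| := fun k x => by
    rw [hv, abs_mul]
    exact mul_le_of_le_one_right (abs_nonneg _) (abs_originCutoff_le _ _)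
  have hev : ∀ x : EuclideanSpace ℝ (Fin n), x ≠ 0 →
      ∀ᶠ k in Filter.atTop, v k =ᶠ[nhds x] u := fun x hx => by
    filter_upwards [eventually_originCutoff_eq_one hx] with k hk
    filter_upwards [hk] with y hy
    rw [hv]
    simp [hy]
  have hne : ∀ᵐ x : EuclideanSpace ℝ (Fin n), x ≠ 0 := by
    simp [ae_iff]
  have t1 : Filter.Tendsto (fun k => ∫ x, ‖gradient (v k) x‖ ^ 2) Filter.atTop
      (nhds (∫ x, ‖gradient u x‖ ^ 2)) := by
    refine tendsto_integral_of_dominated_convergence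
      (fun x => 2 * ‖gradient u x‖ ^ 2 + 2 * M ^ 2 * (u x ^ 2 / ‖x‖ ^ 2))
      (fun k => ((continuous_gradient (hvc k)).norm.pow 2).aestronglyMeasurable)
      ((hgi.const_mul _).add (hhi.const_mul _)) (fun k => ?_) ?_
    · filter_upwards [hne] with x hx
      rw [Real.norm_of_nonneg (sq_nonneg _)]
      exact norm_sq_gradient_mul_originCutoff_le hM (hu.differentiable (by norm_num) x) hx k
    · filter_upwards [hne] with x hx
      refine tendsto_const_nhds.congr' ?_
      filter_upwards [hev x hx] with k hk
      rw [hk.gradient_eq]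
  have t2 : Filter.Tendsto (fun k => ∫ x, v k x ^ 2 / ‖x‖ ^ 2) Filter.atTop
      (nhds (∫ x, u x ^ 2 / ‖x‖ ^ 2)) := by
    refine tendsto_integral_of_dominated_convergence _
      (fun k => (((hvc k).continuous.measurable.pow_const 2).div
        (continuous_norm.measurable.pow_const 2)).aestronglyMeasurable)
      hhi (fun k => Filter.Eventually.of_forall fun x => ?_) ?_
    · rw [Real.norm_of_nonneg (by positivity), ← sq_abs, ← sq_abs (u x)]
      exact div_le_div_of_nonneg_right (pow_le_pow_left₀ (abs_nonneg _) (hvle k x) 2)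
        (sq_nonneg _)
    · filter_upwards [hne] with x hx
      refine tendsto_const_nhds.congr' ?_
      filter_upwards [hev x hx] with k hk
      rw [hk.eq_of_nhds]
  have t3 : Filter.Tendsto (fun k => ∫ x, W x * |v k x| ^ (2 * (n : ℝ) / (n - 2))) Filter.atTop
      (nhds (∫ x, W x * |u x| ^ (2 * (n : ℝ) / (n - 2)))) := by
    refine tendsto_integral_of_dominated_convergence _
      (fun k => (hWm.mul ((hvc k).continuous.abs.rpow_const
        fun _ => Or.inr hp.le).measurable).aestronglyMeasurable)
      hQi (fun k => Filter.Eventually.of_forall fun x => ?_) ?_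
    · rcases lt_or_ge ‖x‖ D with hx | hx
      · have h0 := Real.rpow_nonneg (hX x hx).1 (2 * ((n : ℝ) - 1) / (n - 2))
        rw [Real.norm_of_nonneg (mul_nonneg h0 (Real.rpow_nonneg (abs_nonneg _) _))]
        exact mul_le_mul_of_nonneg_left (Real.rpow_le_rpow (abs_nonneg _) (hvle k x) hp.le) h0
      · simp [hv, hz x hx, Real.zero_rpow hp.ne']
    · filter_upwards [hne] with x hx
      refine tendsto_const_nhds.congr' ?_
      filter_upwards [hev x hx] with k hk
      rw [hk.eq_of_nhds]
  have hθ : 0 ≤ ((n : ℝ) - 2) / n := div_nonneg hn2.le (by linarith)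
  refine le_of_tendsto_of_tendsto ((t3.rpow_const (Or.inr hθ)).const_mul _)
    (t1.sub (t2.const_mul _)) ?_
  filter_upwards [Filter.eventually_ge_atTop 1, Filter.eventually_gt_atTop ⌈D⁻¹⌉₊] with k hk hk2
  have hk0 : (0 : ℝ) < k := by exact_mod_cast hk
  refine hardy_sobolev_annulus hn hD ha hnκ hκa (inv_pos.2 hk0) ?_ le_rfl (hvc k)
    (fun x hx => by simp only [hv]; rw [originCutoff_eq_zero hk0 hx, mul_zero])
    (fun x hx => by simp only [hv]; rw [hz x hx, zero_mul])
  rw [inv_le_comm₀ hk0 hD]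
  exact (Nat.le_ceil _).trans (by exact_mod_cast hk2.le)

theorem norm_lt_sSup_norm_of_isOpen {F : Type*} [NormedAddCommGroup F] [NormedSpace ℝ F]
    {s : Set F} (hs : IsOpen s) (hb : Bornology.IsBounded s) {x : F} (hx : x ∈ s) (hx0 : x ≠ 0) :
    ‖x‖ < sSup ((fun x => ‖x‖) '' s) := by
  have hp := norm_pos_iff.2 hx0
  have hbdd : BddAbove ((fun x => ‖x‖) '' s) := by
    obtain ⟨R, hR⟩ := hb.exists_norm_le
    exact ⟨R, by rintro _ ⟨y, hy, rfl⟩; exact hR y hy⟩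
  have hc : Filter.Tendsto (fun t : ℝ => t • x) (nhdsWithin 1 (Set.Ioi 1)) (nhds x) := by
    have : Continuous fun t : ℝ => t • x := by fun_prop
    simpa using (this.tendsto 1).mono_left nhdsWithin_le_nhds
  obtain ⟨t, ht, ht1⟩ := ((hc.eventually (hs.mem_nhds hx)).and self_mem_nhdsWithin).exists
  have h1 : ‖t • x‖ ≤ sSup ((fun x => ‖x‖) '' s) := le_csSup hbdd ⟨_, ht, rfl⟩
  have ht1' : 1 < t := ht1
  rw [norm_smul, Real.norm_of_nonneg (by linarith)] at h1
  nlinarith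

theorem stmt14 (n : ℕ) (hn : 3 ≤ n)
    (Ω : Set (EuclideanSpace ℝ (Fin n))) (hΩo : IsOpen Ω) (hΩc : IsConnected Ω)
    (hΩb : Bornology.IsBounded Ω) (h0 : (0 : EuclideanSpace ℝ (Fin n)) ∈ Ω)
    (D : ℝ) (hD : D = sSup ((fun x : EuclideanSpace ℝ (Fin n) => ‖x‖) '' Ω))
    (a : ℝ) (ha0 : 0 < a)
    (Cna : ℝ)
    (hCna : Cna = if 1 / ((n : ℝ) - 2) ≤ a then ((n : ℝ) - 2) ^ (-(2 * ((n : ℝ) - 1)) / (n : ℝ)) * sobolevConst n else a ^ (2 * ((n : ℝ) - 1) / (n : ℝ)) * sobolevConst n)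
    (u : EuclideanSpace ℝ (Fin n) → ℝ) (hu : ContDiff ℝ (⊤ : ℕ∞) u)
    (hcs : HasCompactSupport u)
    (hsupp : tsupport u ⊆ Ω) :
    (∫ x in Ω, ‖gradient u x‖ ^ 2)
      ≥ (((n : ℝ) - 2) / 2) ^ 2 *
          (∫ x in Ω, u x ^ 2 / ‖x‖ ^ 2)
        + Cna *
          (∫ x in Ω,
              (X1 a (‖x‖ / D)) ^ (2 * ((n : ℝ) - 1) / ((n : ℝ) - 2)) *
                |u x| ^ (2 * (n : ℝ) / ((n : ℝ) - 2)))
            ^ (((n : ℝ) - 2) / (n : ℝ)) := by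
  have hn3 : (3 : ℝ) ≤ n := by exact_mod_cast hn
  have hn2 : 0 < (n : ℝ) - 2 := by linarith
  have hp : 0 < 2 * (n : ℝ) / (n - 2) := by positivity
  have : Nontrivial (EuclideanSpace ℝ (Fin n)) := by
    have : Nontrivial (Fin n) := Fin.nontrivial_iff_two_le.2 (by omega)
    infer_instance
  have hlt : ∀ x ∈ Ω, x ≠ 0 → ‖x‖ < D := fun x hx hx0 =>
    hD ▸ norm_lt_sSup_norm_of_isOpen hΩo hΩb hx hx0
  have hDpos : 0 < D := by
    have hne : (nhdsWithin (0 : EuclideanSpace ℝ (Fin n)) {0}ᶜ).NeBot :=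
      Module.punctured_nhds_neBot ℝ _ 0
    obtain ⟨x, hx, hx0⟩ := Filter.nonempty_of_mem (Filter.inter_mem
      (nhdsWithin_le_nhds (s := {(0 : EuclideanSpace ℝ (Fin n))}ᶜ) (hΩo.mem_nhds h0))
      self_mem_nhdsWithin)
    exact (norm_nonneg x).trans_lt (hlt x hx hx0)
  have hoff : ∀ x, x ∉ Ω → u x = 0 := fun x hx =>
    image_eq_zero_of_notMem_tsupport fun h => hx (hsupp h)
  have hgoff : ∀ x, x ∉ Ω → gradient u x = 0 := fun x hx =>
    gradient_eq_zero_of_eventuallyEq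
      (notMem_tsupport_iff_eventuallyEq.1 fun h => hx (hsupp h))
  have hz : ∀ x, D ≤ ‖x‖ → u x = 0 := fun x hx => hoff x fun h =>
    absurd (hlt x h (norm_pos_iff.1 (hDpos.trans_le hx))) (not_lt.2 hx)
  rw [setIntegral_eq_integral_of_forall_compl_eq_zero fun x hx => by simp [hgoff x hx],
    setIntegral_eq_integral_of_forall_compl_eq_zero fun x hx => by simp [hoff x hx],
    setIntegral_eq_integral_of_forall_compl_eq_zero fun x hx => by
      simp [hoff x hx, Real.zero_rpow hp.ne']]
  have key : ∀ κ : ℝ, (n : ℝ) - 2 ≤ κ → 1 ≤ κ * a →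
      Cna = κ ^ (-(2 * ((n : ℝ) - 1)) / n) * sobolevConst n → _ := fun κ h1 h2 h3 =>
    h3 ▸ hardy_sobolev_ball hn hDpos ha0 h1 h2 (hu.of_le (by exact_mod_cast le_top)) hz
  rw [ge_iff_le, ← le_sub_iff_add_le']
  split_ifs at hCna with h
  · exact key _ le_rfl (by rwa [div_le_iff₀' hn2] at h) hCna
  · rw [not_le, lt_div_iff₀ hn2] at h
    refine key a⁻¹ ?_ (inv_mul_cancel₀ ha0.ne').ge ?_
    · rw [le_inv_comm₀ hn2 ha0, ← one_div, le_div_iff₀ hn2]; exact h.le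
    · rw [hCna, Real.inv_rpow ha0.le, neg_div, Real.rpow_neg ha0.le, inv_inv]
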